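/- arXiv:1307.2604 — 3 statements merged into one kernel-verified Lean document; each statement's English description precedes it below -/
import Mathlib

section
/- If X is a Hausdorff space, f : X → [0,∞) has an arcwise-connected graph, and an arc [x, x₀] ⊆ X is a semi-skyhook for f with infinity point x₀, then there exists a skyhook C for f with infinity point x₀ containing some semi-skyhook [x', x₀] ⊆ [x, x₀] with infinity point x₀. -/
open Real Filter Set

/-- `L` is a semi-skyhook for `f` with infinity point `p`: there is a homeomorphic
parametrization `h` of the arc `L` by `[0,1]` with `h 1 = p`, `f ∘ h` continuous on `[0,1)`
and `f (h t) → +∞` as `t → 1`. -/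
def IsSemiSkyhook {X : Type*} [TopologicalSpace X] (f : X → ℝ) (L : Set X) (p : X) : Prop :=
  ∃ h : ℝ → X, ContinuousOn h (Icc 0 1) ∧ InjOn h (Icc 0 1) ∧
    h '' Icc 0 1 = L ∧ h 1 = p ∧
    ContinuousOn (f ∘ h) (Ico 0 1) ∧
    Tendsto (f ∘ h) (nhdsWithin 1 (Iio 1)) atTop

/-- `C` is a skyhook for `f` with infinity point `p`: there is a parametrization `h` of
`C` by `[0,2π]` (injective on `[0,2π)`, with endpoints identified, i.e. a homeomorphism
from the unit circle) with `h 0 = p`, such that `φ ↦ f (h φ)` is continuous on `[0,2π)`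
and tends to `+∞` as `φ → 2π`. -/
def IsSkyhook {X : Type*} [TopologicalSpace X] (f : X → ℝ) (C : Set X) (p : X) : Prop :=
  ∃ h : ℝ → X, ContinuousOn h (Icc 0 (2 * π)) ∧ InjOn h (Ico 0 (2 * π)) ∧
    h '' Icc 0 (2 * π) = C ∧ h 0 = p ∧ h (2 * π) = h 0 ∧
    ContinuousOn (f ∘ h) (Ico 0 (2 * π)) ∧
    Tendsto (f ∘ h) (nhdsWithin (2 * π) (Iio (2 * π))) atTop


section ArcLemmas

lemma sk_exists_min {Y : Type*} [TopologicalSpace Y] [T2Space Y] (γ : ℝ → Y)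
    (hγ : Continuous γ) :
    ∃ K : Set ℝ, K ⊆ Icc 0 1 ∧ IsClosed K ∧ 0 ∈ K ∧ 1 ∈ K ∧
      (∀ a ∈ K, ∀ b ∈ K, a < b → (∀ c ∈ K, a < c → c < b → False) → γ a = γ b) ∧
      (∀ s ∈ K, ∀ t ∈ K, s < t → γ s = γ t → ∀ c ∈ K, s < c → c < t → False) := by
  let S : Set (Set ℝ) := {K | K ⊆ Icc 0 1 ∧ IsClosed K ∧ 0 ∈ K ∧ 1 ∈ K ∧
      (∀ a ∈ K, ∀ b ∈ K, a < b → (∀ c ∈ K, a < c → c < b → False) → γ a = γ b)}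
  have hz : ∃ m, Minimal (· ∈ S) m := by
    apply zorn_superset
    intro c hcS hc
    rcases c.eq_empty_or_nonempty with rfl | hne
    · refine ⟨Icc 0 1, ⟨subset_rfl, isClosed_Icc, by simp, by simp, ?_⟩, by simp⟩
      intro a ha b hb hab h
      exact (h ((a + b) / 2) ⟨by linarith [ha.1, hb.1], by linarith [ha.2, hb.2]⟩
        (by linarith) (by linarith)).elim
    · refine ⟨⋂₀ c, ⟨?_, ?_, ?_, ?_, ?_⟩, fun s hs => sInter_subset_of_mem hs⟩
      · obtain ⟨k, hk⟩ := hne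
        exact (sInter_subset_of_mem hk).trans (hcS hk).1
      · exact isClosed_sInter fun k hk => (hcS hk).2.1
      · exact fun k hk => (hcS hk).2.2.1
      · exact fun k hk => (hcS hk).2.2.2.1
      · intro a ha b hb hab hgap
        by_contra hne'
        obtain ⟨U, V, hU, hV, haU, hbV, hUV⟩ := t2_separation hne'
        obtain ⟨e1, he1, h1⟩ := Metric.isOpen_iff.1 (hU.preimage hγ) a haU
        obtain ⟨e2, he2, h2⟩ := Metric.isOpen_iff.1 (hV.preimage hγ) b hbV
        obtain ⟨d, hd0, hd⟩ : ∃ d, 0 < d ∧ d < min (min e1 e2) ((b - a) / 2) :=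
          exists_between (by simp [he1, he2, hab])
        simp only [lt_min_iff] at hd
        obtain ⟨⟨hd1, hd2⟩, hd3⟩ := hd
        have : Nonempty c := hne.to_subtype
        have hdis : (Icc (a + d) (b - d) ∩ ⋂ i : c, (i : Set ℝ)) = ∅ := by
          rw [← sInter_eq_iInter]
          ext x
          simp only [mem_inter_iff, mem_Icc, mem_empty_iff_false, iff_false]
          rintro ⟨⟨hx1, hx2⟩, hx⟩
          exact hgap x hx (by linarith) (by linarith)
        obtain ⟨⟨K, hKc⟩, hK⟩ := isCompact_Icc.elim_directed_family_closed
          (fun i : c => (i : Set ℝ)) (fun i => (hcS i.2).2.1) hdis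
          (by
            rintro ⟨i, hi⟩ ⟨j, hj⟩
            rcases hc.total hi hj with h | h
            · exact ⟨⟨i, hi⟩, subset_rfl, h⟩
            · exact ⟨⟨j, hj⟩, h, subset_rfl⟩)
        have hKcl : IsClosed K := (hcS hKc).2.1
        have hA := (isCompact_Icc.inter_left hKcl).sSup_mem (s := K ∩ Icc a (a + d))
          ⟨a, ha K hKc, by simp [hd0.le]⟩
        have hB := (isCompact_Icc.inter_left hKcl).sInf_mem (s := K ∩ Icc (b - d) b)
          ⟨b, hb K hKc, by simp [hd0.le]⟩
        have hA' : ∀ x ∈ K ∩ Icc a (a + d), x ≤ sSup (K ∩ Icc a (a + d)) := fun x hx =>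
          le_csSup ((isCompact_Icc.inter_left hKcl).bddAbove) hx
        have hB' : ∀ x ∈ K ∩ Icc (b - d) b, sInf (K ∩ Icc (b - d) b) ≤ x := fun x hx =>
          csInf_le ((isCompact_Icc.inter_left hKcl).bddBelow) hx
        generalize sSup (K ∩ Icc a (a + d)) = α at *
        generalize sInf (K ∩ Icc (b - d) b) = β at *
        obtain ⟨hαK, hα1, hα2⟩ := hA
        obtain ⟨hβK, hβ1, hβ2⟩ := hB
        have heq := (hcS hKc).2.2.2.2 α hαK β hβK (by linarith) (by
          intro x hx hx1 hx2
          by_cases hxa : x ≤ a + d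
          · linarith [hA' x ⟨hx, by linarith, hxa⟩]
          · by_cases hxb : b - d ≤ x
            · linarith [hB' x ⟨hx, hxb, by linarith⟩]
            · have : x ∈ Icc (a + d) (b - d) ∩ K := ⟨⟨by linarith, by linarith⟩, hx⟩
              simp only at hK
              rw [hK] at this
              exact this)
        have hαU : γ α ∈ U := h1 (by rw [Metric.mem_ball, Real.dist_eq, abs_lt]; constructor <;> linarith)
        have hβV : γ β ∈ V := h2 (by rw [Metric.mem_ball, Real.dist_eq, abs_lt]; constructor <;> linarith)
        rw [heq] at hαU
        exact disjoint_left.1 hUV hαU hβV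
  obtain ⟨K, ⟨hK1, hK2, hK3, hK4, hK5⟩, hmin⟩ := hz
  refine ⟨K, hK1, hK2, hK3, hK4, hK5, ?_⟩
  intro s hs t ht hst heq c hc hsc hct
  have hmem : K \ Ioo s t ∈ S := by
    refine ⟨sdiff_subset.trans hK1, hK2.sdiff isOpen_Ioo, ⟨hK3, ?_⟩, ⟨hK4, ?_⟩, ?_⟩
    · rintro ⟨h, -⟩
      linarith [(hK1 hs).1]
    · rintro ⟨-, h⟩
      linarith [(hK1 ht).2]
    · rintro a ⟨ha, ha'⟩ b ⟨hb, hb'⟩ hab hgap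
      by_cases hex : ∃ x ∈ K, a < x ∧ x < b
      · obtain ⟨x, hx, hax, hxb⟩ := hex
        have hx' : x ∈ Ioo s t := by
          by_contra hcon
          exact hgap x ⟨hx, hcon⟩ hax hxb
        have h1 : a ≤ s := by
          by_contra hcon
          exact ha' ⟨by linarith, by linarith [hx'.2]⟩
        have h2 : t ≤ b := by
          by_contra hcon
          exact hb' ⟨by linarith [hx'.1], by linarith⟩
        have h3 : a = s := by
          by_contra hcon
          exact hgap s ⟨hs, fun h => lt_irrefl _ h.1⟩ (lt_of_le_of_ne h1 hcon) (by linarith)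
        have h4 : t = b := by
          by_contra hcon
          exact hgap t ⟨ht, fun h => lt_irrefl _ h.2⟩ (by linarith) (lt_of_le_of_ne h2 hcon)
        rw [h3, ← h4, heq]
      · exact hK5 a ha b hb hab fun x hx h1 h2 => hex ⟨x, hx, h1, h2⟩
  exact (hmin hmem sdiff_subset hc).2 ⟨hsc, hct⟩

lemma sk_running_sup {K : Type*} [TopologicalSpace K] [CompactSpace K] [LinearOrder K]
    [OrderClosedTopology K] (v : K → ℝ) (hv : Continuous v) :
    ∃ M : K → ℝ, Continuous M ∧ Monotone M ∧ (∀ t, v t ≤ M t) ∧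
      (∀ t B, (∀ s ≤ t, v s ≤ B) → M t ≤ B) := by
  let F : K → K → ℝ := fun t s => v (min s t)
  have hbdd : ∀ t, BddAbove (F t '' univ) := fun t =>
    (isCompact_univ.image (hv.comp (continuous_id.min continuous_const))).bddAbove
  have h1 : ∀ t s, s ≤ t → v s ≤ sSup (F t '' univ) := fun t s hs =>
    le_csSup (hbdd t) ⟨s, trivial, by simp [F, min_eq_left hs]⟩
  have h2 : ∀ t B, (∀ s ≤ t, v s ≤ B) → sSup (F t '' univ) ≤ B := by
    intro t B h
    apply csSup_le ⟨F t t, mem_image_of_mem (F t) (mem_univ t)⟩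
    rintro _ ⟨s, -, rfl⟩
    exact h _ (min_le_right _ _)
  refine ⟨fun t => sSup (F t '' univ), ?_, ?_, fun t => h1 t t le_rfl, h2⟩
  · apply isCompact_univ.continuous_sSup
    exact hv.comp (continuous_snd.min continuous_fst)
  · intro s t hst
    exact h2 _ _ fun r hr => h1 _ _ (hr.trans hst)

lemma sk_sep {Y : Type*} [TopologicalSpace Y] [T2Space Y] (K : Set ℝ) [CompactSpace K]
    (w : K → Y) (hw : Continuous w)
    (hK : ∀ s t : K, s < t → w s = w t → ∀ c : K, s < c → c < t → False) (p q : ℝ) :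
    ∃ M : K → ℝ, Continuous M ∧ Monotone M ∧ (∀ t, 0 ≤ M t ∧ M t ≤ 1) ∧
      (∀ s t, w s = w t → M s = M t) ∧
      ((∃ c : K, p < c ∧ c < q) → (∀ t : K, t ≤ p → M t = 0) ∧ (∀ t : K, q ≤ t → M t = 1)) := by
  by_cases hc : ∃ c : K, p < c ∧ c < q
  swap
  · exact ⟨fun _ => 0, continuous_const, monotone_const, by simp, by simp, fun h => (hc h).elim⟩
  obtain ⟨c, hpc, hcq⟩ := hc
  have hcZ : CompactSpace (range w) := isCompact_iff_compactSpace.1 (isCompact_range hw)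
  let z : K → range w := fun k => ⟨w k, mem_range_self k⟩
  have hz : Continuous z := hw.subtype_mk _
  have hcl1 : IsClosed (z '' {k | (k : ℝ) ≤ p}) :=
    ((isClosed_le continuous_subtype_val continuous_const).isCompact.image hz).isClosed
  have hcl2 : IsClosed (z '' {k | q ≤ (k : ℝ)}) :=
    ((isClosed_le continuous_const continuous_subtype_val).isCompact.image hz).isClosed
  have hdis : Disjoint (z '' {k | (k : ℝ) ≤ p}) (z '' {k | q ≤ (k : ℝ)}) := by
    rw [disjoint_left]
    rintro _ ⟨s, hs, rfl⟩ ⟨t, ht, hst⟩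
    have hst' : w t = w s := congrArg Subtype.val hst
    simp only [mem_ofPred_eq] at hs ht
    have hsc : s < c := Subtype.coe_lt_coe.1 (by linarith)
    have hct : c < t := Subtype.coe_lt_coe.1 (by linarith)
    exact hK s t (hsc.trans hct) hst'.symm c hsc hct
  obtain ⟨u, hu0, hu1, hu⟩ := exists_continuous_zero_one_of_isClosed hcl1 hcl2 hdis
  obtain ⟨M, hM1, hM2, hM3, hM4⟩ := sk_running_sup (fun k => u (z k)) (u.continuous.comp hz)
  have hM5 : ∀ t, 0 ≤ M t ∧ M t ≤ 1 := fun t =>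
    ⟨(hu _).1.trans (hM3 t), hM4 t 1 fun s _ => (hu _).2⟩
  have key : ∀ s t, s < t → w s = w t → M s = M t := by
    intro s t hst hw
    apply le_antisymm (hM2 hst.le)
    apply hM4
    intro r hr
    rcases le_or_gt r s with h | h
    · exact (hM3 r).trans (hM2 h)
    · rcases hr.eq_or_lt with rfl | h'
      · have : z r = z s := Subtype.ext hw.symm
        rw [this]
        exact hM3 s
      · exact (hK s t hst hw r h h').elim
  refine ⟨M, hM1, hM2, hM5, ?_, fun _ => ⟨?_, ?_⟩⟩
  · intro s t hw
    rcases lt_trichotomy s t with h | h | h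
    · exact key s t h hw
    · rw [h]
    · exact (key t s h hw.symm).symm
  · intro t ht
    apply le_antisymm _ (hM5 t).1
    apply hM4
    intro s hs
    have : u (z s) = 0 := hu0 ⟨s, (show (s : ℝ) ≤ t from hs).trans ht, rfl⟩
    exact this.le
  · intro t ht
    apply le_antisymm (hM5 t).2
    have : u (z t) = 1 := hu1 ⟨t, ht, rfl⟩
    exact this.symm.le.trans (hM3 t)

lemma sk_phi {Y : Type*} [TopologicalSpace Y] [T2Space Y] (K : Set ℝ) [CompactSpace K]
    (w : K → Y) (hw : Continuous w)
    (hK : ∀ s t : K, s < t → w s = w t → ∀ c : K, s < c → c < t → False)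
    (hG : ∀ s t : K, s < t → (∀ c : K, s < c → c < t → False) → w s = w t) :
    ∃ φ : K → ℝ, Continuous φ ∧ Monotone φ ∧ (∀ s t, φ s = φ t ↔ w s = w t) := by
  choose M hM1 hM2 hM3 hM4 hM5 using fun i : ℚ × ℚ => sk_sep K w hw hK (i.1 : ℝ) (i.2 : ℝ)
  have hsum : Summable fun i : ℚ × ℚ => ((1 : ℝ) / 2) ^ Encodable.encode i :=
    summable_geometric_two_encode
  have hle : ∀ i t, ((1 : ℝ) / 2) ^ Encodable.encode i * M i t ≤ (1 / 2) ^ Encodable.encode i :=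
    fun i t => mul_le_of_le_one_right (by positivity) (hM3 i t).2
  have hnn : ∀ i t, 0 ≤ ((1 : ℝ) / 2) ^ Encodable.encode i * M i t :=
    fun i t => mul_nonneg (by positivity) (hM3 i t).1
  have hs : ∀ t, Summable fun i => ((1 : ℝ) / 2) ^ Encodable.encode i * M i t := fun t =>
    Summable.of_nonneg_of_le (fun i => hnn i t) (fun i => hle i t) hsum
  have hmono : ∀ s t, s ≤ t → ∀ i, ((1 : ℝ) / 2) ^ Encodable.encode i * M i s ≤
      (1 / 2) ^ Encodable.encode i * M i t := fun s t hst i =>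
    mul_le_mul_of_nonneg_left (hM2 i hst) (by positivity)
  have key : ∀ s t, s < t → w s ≠ w t →
      (∑' i, ((1 : ℝ) / 2) ^ Encodable.encode i * M i s) <
      ∑' i, ((1 : ℝ) / 2) ^ Encodable.encode i * M i t := by
    intro s t hst hne
    obtain ⟨c, hsc, hct⟩ : ∃ c : K, s < c ∧ c < t := by
      by_contra hcon
      exact hne (hG s t hst fun c h1 h2 => hcon ⟨c, h1, h2⟩)
    obtain ⟨p, hp1, hp2⟩ := exists_rat_btwn (show (s : ℝ) < c from hsc)
    obtain ⟨q, hq1, hq2⟩ := exists_rat_btwn (show (c : ℝ) < t from hct)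
    obtain ⟨h0, h1⟩ := hM5 (p, q) ⟨c, hp2, hq1⟩
    refine Summable.tsum_lt_tsum (i := (p, q)) (hmono s t hst.le) ?_ (hs s) (hs t)
    rw [h0 s hp1.le, h1 t hq2.le, mul_zero, mul_one]
    positivity
  refine ⟨fun t => ∑' i, ((1 : ℝ) / 2) ^ Encodable.encode i * M i t, ?_, ?_, ?_⟩
  · refine continuous_tsum (fun i => continuous_const.mul (hM1 i)) hsum ?_
    intro i t
    rw [Real.norm_of_nonneg (hnn i t)]
    exact hle i t
  · intro s t hst
    exact Summable.tsum_le_tsum (hmono s t hst) (hs s) (hs t)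
  · intro s t
    constructor
    · intro h
      by_contra hne
      rcases lt_trichotomy s t with h' | h' | h'
      · exact (key s t h' hne).ne h
      · exact hne (by rw [h'])
      · exact (key t s h' (Ne.symm hne)).ne h.symm
    · intro h
      simp only
      congr 1
      ext i
      rw [hM4 i s t h]

lemma sk_arc {Y : Type*} [TopologicalSpace Y] [T2Space Y] (γ : ℝ → Y)
    (hγ : Continuous γ) (hne : γ 0 ≠ γ 1) :
    ∃ (A B : ℝ) (a : ℝ → Y), A < B ∧ ContinuousOn a (Icc A B) ∧ InjOn a (Icc A B) ∧
      a A = γ 0 ∧ a B = γ 1 ∧ ∀ y ∈ Icc A B, a y ∈ γ '' Icc 0 1 := by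
  obtain ⟨K, hK1, hK2, hK3, hK4, hK5, hK6⟩ := sk_exists_min γ hγ
  have hKc : IsCompact K := isCompact_Icc.of_isClosed_subset hK2 hK1
  have : CompactSpace K := isCompact_iff_compactSpace.1 hKc
  let w : K → Y := fun k => γ k
  have hw : Continuous w := hγ.comp continuous_subtype_val
  have hKK : ∀ s t : K, s < t → w s = w t → ∀ c : K, s < c → c < t → False :=
    fun s t hst h c h1 h2 => hK6 s s.2 t t.2 hst h c c.2 h1 h2
  have hG : ∀ s t : K, s < t → (∀ c : K, s < c → c < t → False) → w s = w t :=
    fun s t hst h => hK5 s s.2 t t.2 hst fun c hc h1 h2 => h ⟨c, hc⟩ h1 h2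
  obtain ⟨φ, hφ1, hφ2, hφ3⟩ := sk_phi K w hw hKK hG
  let k0 : K := ⟨0, hK3⟩
  let k1 : K := ⟨1, hK4⟩
  have hk0 : ∀ k, k0 ≤ k := fun k => (hK1 k.2).1
  have hk1 : ∀ k, k ≤ k1 := fun k => (hK1 k.2).2
  have hlt : φ k0 < φ k1 := lt_of_le_of_ne (hφ2 (hk0 _)) fun h => hne ((hφ3 _ _).1 h)
  have hsurj : ∀ y ∈ Icc (φ k0) (φ k1), ∃ k, φ k = y := by
    intro y hy
    by_contra hcon
    push Not at hcon
    have hc1 : IsCompact {k | φ k ≤ y} := (isClosed_le hφ1 continuous_const).isCompact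
    have hc2 : IsCompact {k | y ≤ φ k} := (isClosed_le continuous_const hφ1).isCompact
    obtain ⟨s, hs, hs'⟩ := hc1.exists_isGreatest ⟨k0, hy.1⟩
    obtain ⟨t, ht, ht'⟩ := hc2.exists_isLeast ⟨k1, hy.2⟩
    simp only [mem_ofPred_eq] at hs ht
    have hsy : φ s < y := lt_of_le_of_ne hs (hcon s)
    have hyt : y < φ t := lt_of_le_of_ne ht (Ne.symm (hcon t))
    have hst : s < t := by
      by_contra h
      linarith [hφ2 (not_lt.1 h)]
    have := hG s t hst (by
      intro c h1 h2
      rcases le_total (φ c) y with h | h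
      · exact absurd (hs' h) (not_le.2 h1)
      · exact absurd (ht' h) (not_le.2 h2))
    have := (hφ3 _ _).2 this
    linarith
  have hKne : Nonempty K := ⟨k0⟩
  choose! ψ hψ using hsurj
  have hmem : ∀ k, φ k ∈ Icc (φ k0) (φ k1) := fun k => ⟨hφ2 (hk0 k), hφ2 (hk1 k)⟩
  have haφ : ∀ k, w (ψ (φ k)) = w k := fun k => (hφ3 _ _).1 (hψ _ (hmem k))
  refine ⟨φ k0, φ k1, fun y => w (ψ y), hlt, ?_, ?_, haφ k0, haφ k1, ?_⟩
  · rw [continuousOn_iff_isClosed]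
    intro C hC
    refine ⟨φ '' (w ⁻¹' C), ((hC.preimage hw).isCompact.image hφ1).isClosed, ?_⟩
    ext y
    constructor
    · rintro ⟨h, hy⟩
      exact ⟨⟨ψ y, h, hψ y hy⟩, hy⟩
    · rintro ⟨⟨k, hk, rfl⟩, hy⟩
      refine ⟨?_, hy⟩
      change w (ψ (φ k)) ∈ C
      rw [haφ]
      exact hk
  · intro x hx y hy hxy
    have := (hφ3 _ _).2 hxy
    rwa [hψ x hx, hψ y hy] at this
  · intro y hy
    exact ⟨ψ y, hK1 (ψ y).2, rfl⟩

end ArcLemmas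

theorem skyhook_from_semiSkyhook
    {X : Type*} [TopologicalSpace X] [T2Space X]
    (f : X → ℝ) (hnonneg : ∀ x, 0 ≤ f x)
    (hgraph : IsPathConnected {p : X × ℝ | p.2 = f p.1})
    (L : Set X) (x₀ : X) (hL : IsSemiSkyhook f L x₀) :
    ∃ C : Set X, IsSkyhook f C x₀ ∧
      ∃ L' : Set X, IsSemiSkyhook f L' x₀ ∧ L' ⊆ L ∧ L' ⊆ C := by
  obtain ⟨h, hc, hinj, rfl, h1, hfc, hft⟩ := hL
  have J := hgraph.joinedIn (x₀, f x₀) rfl (h 0, f (h 0)) rfl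
  obtain ⟨G, hGc, hG0, hG1, hGm⟩ : ∃ G : ℝ → X × ℝ, Continuous G ∧ G 0 = (x₀, f x₀) ∧
      G 1 = (h 0, f (h 0)) ∧ ∀ t, (G t).2 = f (G t).1 :=
    ⟨J.somePath.extend, J.somePath.continuous_extend, by simp, by simp,
      fun t => J.somePath_mem _⟩
  obtain ⟨M, hM⟩ : ∃ M, ∀ t ∈ Icc (0 : ℝ) 1, (G t).2 ≤ M := by
    obtain ⟨M, hM⟩ := (isCompact_Icc (a := (0 : ℝ)) (b := 1)).bddAbove_image
      (continuous_snd.comp hGc).continuousOn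
    exact ⟨M, fun t ht => hM ⟨t, ht, rfl⟩⟩
  obtain ⟨t0, ht0, ht01, ht0M⟩ : ∃ t0 : ℝ, 0 ≤ t0 ∧ t0 < 1 ∧
      ∀ t, t0 < t → t < 1 → M < f (h t) := by
    have hev := hft.eventually (eventually_gt_atTop M)
    obtain ⟨l, hl, hl'⟩ := (mem_nhdsLT_iff_exists_Ioo_subset).1 hev
    refine ⟨max l 0, le_max_right _ _, max_lt hl one_pos, fun t h1 h2 => ?_⟩
    exact hl' ⟨(le_max_left _ _).trans_lt h1, h2⟩
  have hKc : IsClosed (h '' Icc 0 t0) :=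
    (isCompact_Icc.image_of_continuousOn (hc.mono (Icc_subset_Icc_right ht01.le))).isClosed
  have hTc : IsCompact (Icc 0 1 ∩ {s | (G s).1 ∈ h '' Icc 0 t0}) :=
    isCompact_Icc.inter_right (hKc.preimage (continuous_fst.comp hGc))
  obtain ⟨s1, ⟨hs1, t1, ht1, hht1⟩, hs1min⟩ := hTc.exists_isLeast
    ⟨1, by simp, 0, ⟨le_rfl, ht0⟩, by rw [hG1]⟩
  have ht1l : t1 < 1 := ht1.2.trans_lt ht01
  have ht1m : t1 ∈ Icc (0 : ℝ) 1 := ⟨ht1.1, ht1l.le⟩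
  have hGs1 : G s1 = (h t1, f (h t1)) := Prod.ext hht1.symm (by rw [hGm, hht1])
  obtain ⟨A, B, a, hAB, hac, hai, haA, haB, ham⟩ := sk_arc (fun t => G (s1 * t))
    (hGc.comp (continuous_const.mul continuous_id)) (by
      simp only [mul_zero, mul_one, hG0, hGs1]
      intro he
      have he1 : x₀ = h t1 := congrArg Prod.fst he
      rw [← h1] at he1
      exact ht1l.ne (hinj (by simp) ht1m he1).symm)
  simp only [mul_zero, mul_one, hG0, hGs1] at haA haB
  have hag : ∀ y ∈ Icc A B, (a y).2 = f (a y).1 := by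
    intro y hy
    obtain ⟨r, -, hr⟩ := ham y hy
    rw [← hr]
    exact hGm _
  have hafi : ∀ y ∈ Icc A B, ∀ y' ∈ Icc A B, (a y).1 = (a y').1 → y = y' := by
    intro y hy y' hy' he
    exact hai hy hy' (Prod.ext he (by rw [hag y hy, hag y' hy', he]))
  have hAm : A ∈ Icc A B := ⟨le_rfl, hAB.le⟩
  have hBm : B ∈ Icc A B := ⟨hAB.le, le_rfl⟩
  have key : ∀ y ∈ Icc A B, ∀ t ∈ Icc t1 1, (a y).1 = h t →
      (y = A ∧ t = 1) ∨ (y = B ∧ t = t1) := by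
    intro y hy t ht he
    have ht' : t ∈ Icc (0 : ℝ) 1 := ⟨ht1.1.trans ht.1, ht.2⟩
    rcases ht.2.eq_or_lt with rfl | htl
    · left
      exact ⟨hafi y hy A hAm (by rw [he, haA, h1]), rfl⟩
    · right
      obtain ⟨r, hr, hry⟩ := ham y hy
      simp only at hry
      have hsr : s1 * r ∈ Icc (0 : ℝ) 1 :=
        ⟨mul_nonneg hs1.1 hr.1, mul_le_one₀ hs1.2 hr.1 hr.2⟩
      have hle : t ≤ t0 := by
        by_contra hcon
        have h3 := ht0M t (not_le.1 hcon) htl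
        have h4 := hM _ hsr
        rw [hry, hag y hy, he] at h4
        linarith
      have h5 : s1 ≤ s1 * r := hs1min ⟨hsr, t, ⟨ht'.1, hle⟩, by rw [hry, he]⟩
      have h6 : s1 * r = s1 := le_antisymm (mul_le_of_le_one_right hs1.1 hr.2) h5
      rw [h6, hGs1] at hry
      refine ⟨hafi y hy B hBm (by rw [← hry, haB]), hinj ht' ht1m ?_⟩
      rw [← he, ← hry]
  have hpi := Real.pi_pos
  -- the affine reparametrizations
  let α : ℝ → ℝ := fun s => A + (B - A) * (s / π)
  let β : ℝ → ℝ := fun s => t1 + (1 - t1) * ((s - π) / π)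
  have hαc : Continuous α := by fun_prop
  have hβc : Continuous β := by fun_prop
  have hαm : StrictMono α := by
    intro s s' hss
    have : s / π < s' / π := by gcongr
    have := mul_lt_mul_of_pos_left this (sub_pos.2 hAB)
    simp only [α]
    linarith
  have hβm : StrictMono β := by
    intro s s' hss
    have : (s - π) / π < (s' - π) / π := by gcongr
    have := mul_lt_mul_of_pos_left this (sub_pos.2 ht1l)
    simp only [β]
    linarith
  have hα0 : α 0 = A := by simp [α]
  have hαπ : α π = B := by simp [α, hpi.ne']
  have hβπ : β π = t1 := by simp [β]
  have hβ2 : β (2 * π) = 1 := by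
    have : (2 * π - π) / π = 1 := by field_simp; ring
    simp [β, this]
  have hαI : ∀ s, 0 ≤ s → s ≤ π → α s ∈ Icc A B := fun s h0 h1 =>
    ⟨hα0 ▸ hαm.monotone h0, hαπ ▸ hαm.monotone h1⟩
  have hβI : ∀ s, π ≤ s → s ≤ 2 * π → β s ∈ Icc t1 1 := fun s h0 h1 =>
    ⟨hβπ ▸ hβm.monotone h0, hβ2 ▸ hβm.monotone h1⟩
  have hI01 : Icc t1 1 ⊆ Icc (0 : ℝ) 1 := Icc_subset_Icc_left ht1.1
  let H : ℝ → X := fun s => if s ≤ π then (a (α s)).1 else h (β s)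
  have hH1 : ∀ s, s ≤ π → H s = (a (α s)).1 := fun s hs => if_pos hs
  have hH2 : ∀ s, π ≤ s → H s = h (β s) := by
    intro s hs
    rcases hs.eq_or_lt with rfl | hs
    · rw [hH1 _ le_rfl, hαπ, haB, hβπ]
    · exact if_neg (not_le.2 hs)
  have hH2π : H (2 * π) = x₀ := by rw [hH2 _ (by linarith), hβ2, h1]
  have hH0 : H 0 = x₀ := by rw [hH1 _ hpi.le, hα0, haA]
  have hcont1 : ContinuousOn (fun s => a (α s)) (Icc 0 π) :=
    hac.comp hαc.continuousOn fun s hs => hαI s hs.1 hs.2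
  refine ⟨H '' Icc 0 (2 * π), ⟨H, ?_, ?_, rfl, hH0, by rw [hH2π, hH0], ?_, ?_⟩,
    h '' Icc t1 1, ?_, image_mono hI01, ?_⟩
  · have e : Icc 0 (2 * π) = Icc 0 π ∪ Icc π (2 * π) :=
      (Icc_union_Icc_eq_Icc hpi.le (by linarith)).symm
    rw [e]
    refine ContinuousOn.union_of_isClosed ?_ ?_ isClosed_Icc isClosed_Icc
    · exact (continuous_fst.comp_continuousOn hcont1).congr fun s hs => hH1 s hs.2
    · exact (hc.comp hβc.continuousOn fun s hs => hI01 (hβI s hs.1 hs.2)).congr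
        fun s hs => hH2 s hs.1
  · have mixed : ∀ s s', 0 ≤ s → s ≤ π → π < s' → s' < 2 * π → H s = H s' → False := by
      intro s s' h0 hs hs' hs2 he
      rw [hH1 s hs, hH2 s' hs'.le] at he
      rcases key _ (hαI s h0 hs) _ (hβI s' hs'.le hs2.le) he with ⟨-, h⟩ | ⟨-, h⟩
      · exact hs2.ne (hβm.injective (h.trans hβ2.symm))
      · exact hs'.ne (hβm.injective (h.trans hβπ.symm)).symm
    rintro s ⟨hs0, hs2⟩ s' ⟨hs0', hs2'⟩ he
    rcases le_or_gt s π with hs | hs <;> rcases le_or_gt s' π with hs' | hs'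
    · rw [hH1 s hs, hH1 s' hs'] at he
      exact hαm.injective (hafi _ (hαI s hs0 hs) _ (hαI s' hs0' hs') he)
    · exact (mixed s s' hs0 hs hs' hs2' he).elim
    · exact (mixed s' s hs0' hs' hs hs2 he.symm).elim
    · rw [hH2 s hs.le, hH2 s' hs'.le] at he
      exact hβm.injective (hinj (hI01 (hβI s hs.le hs2.le)) (hI01 (hβI s' hs'.le hs2'.le)) he)
  · have hc1 : ContinuousOn (f ∘ H) (Icc 0 π) := by
      refine (continuous_snd.comp_continuousOn hcont1).congr fun s hs => ?_
      simp only [Function.comp]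
      rw [hH1 s hs.2, hag _ (hαI s hs.1 hs.2)]
    have hc2 : ContinuousOn (f ∘ H) (Ico π (2 * π)) := by
      refine (hfc.comp hβc.continuousOn fun s hs => ?_).congr fun s hs => ?_
      · exact ⟨(hI01 (hβI s hs.1 hs.2.le)).1, hβ2 ▸ hβm hs.2⟩
      · simp only [Function.comp]
        rw [hH2 s hs.1]
    intro s hs
    have e : Ico 0 (2 * π) = Icc 0 π ∪ Ico π (2 * π) :=
      (Icc_union_Ico_eq_Ico hpi.le (by linarith)).symm
    rw [e]
    apply ContinuousWithinAt.union
    · by_cases hsp : s ≤ π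
      · exact hc1 s ⟨hs.1, hsp⟩
      · apply continuousWithinAt_of_notMem_closure
        rw [isClosed_Icc.closure_eq]
        exact fun h => hsp h.2
    · by_cases hsp : π ≤ s
      · exact hc2 s ⟨hsp, hs.2⟩
      · apply continuousWithinAt_of_notMem_closure
        intro h
        exact hsp (closure_minimal Ico_subset_Icc_self isClosed_Icc h).1
  · have hev : f ∘ H =ᶠ[nhdsWithin (2 * π) (Iio (2 * π))] (f ∘ h) ∘ β := by
      have : Ioo π (2 * π) ∈ nhdsWithin (2 * π) (Iio (2 * π)) :=
        Ioo_mem_nhdsLT (by linarith)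
      filter_upwards [this] with s hs
      simp only [Function.comp]
      rw [hH2 s hs.1.le]
    refine Tendsto.congr' hev.symm (hft.comp ?_)
    apply tendsto_nhdsWithin_of_tendsto_nhds_of_eventually_within
    · have := hβc.tendsto (2 * π)
      rw [hβ2] at this
      exact this.mono_left nhdsWithin_le_nhds
    · filter_upwards [self_mem_nhdsWithin] with s hs
      exact hβ2 ▸ hβm hs
  · let δ : ℝ → ℝ := fun s => t1 + (1 - t1) * s
    have hδc : Continuous δ := by fun_prop
    have hpos : 0 < 1 - t1 := sub_pos.2 ht1l
    have hδm : StrictMono δ := by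
      intro s s' hss
      have := mul_lt_mul_of_pos_left hss hpos
      simp only [δ]
      linarith
    have hδ0 : δ 0 = t1 := by simp [δ]
    have hδ1 : δ 1 = 1 := by simp [δ]
    have hδI : ∀ s, 0 ≤ s → s ≤ 1 → δ s ∈ Icc t1 1 := fun s h0 h1 =>
      ⟨hδ0 ▸ hδm.monotone h0, hδ1 ▸ hδm.monotone h1⟩
    refine ⟨h ∘ δ, ?_, ?_, ?_, ?_, ?_, ?_⟩
    · exact hc.comp hδc.continuousOn fun s hs => hI01 (hδI s hs.1 hs.2)
    · intro s hs s' hs' he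
      exact hδm.injective (hinj (hI01 (hδI s hs.1 hs.2)) (hI01 (hδI s' hs'.1 hs'.2)) he)
    · rw [image_comp]
      congr 1
      apply Subset.antisymm
      · rintro _ ⟨s, hs, rfl⟩
        exact hδI s hs.1 hs.2
      · have := intermediate_value_Icc (zero_le_one (α := ℝ)) hδc.continuousOn
        rwa [hδ0, hδ1] at this
    · simp only [Function.comp, hδ1, h1]
    · exact hfc.comp hδc.continuousOn fun s hs =>
        ⟨(hI01 (hδI s hs.1 hs.2.le)).1, hδ1 ▸ hδm hs.2⟩
    · refine hft.comp ?_
      apply tendsto_nhdsWithin_of_tendsto_nhds_of_eventually_within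
      · have := hδc.tendsto 1
        rw [hδ1] at this
        exact this.mono_left nhdsWithin_le_nhds
      · filter_upwards [self_mem_nhdsWithin] with s hs
        exact hδ1 ▸ hδm hs
  · rintro _ ⟨t, ht, rfl⟩
    have := intermediate_value_Icc (show π ≤ 2 * π by linarith) hβc.continuousOn
    rw [hβπ, hβ2] at this
    obtain ⟨s, hs, rfl⟩ := this ht
    exact ⟨s, ⟨hpi.le.trans hs.1, hs.2⟩, hH2 s hs.1⟩
end

section
/- If C ⊆ ℝ² is homeomorphic to the unit circle, then ℝ² \ C has exactly two connected components, one bounded and one unbounded, and C is the boundary of each. -/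
open Set

/-- The plane. -/
abbrev Plane := EuclideanSpace ℝ (Fin 2)

/-- The unit circle in the plane. -/
abbrev unitCircle : Set Plane := Metric.sphere (0 : Plane) 1

namespace JordanAux

/-- Homotopy lifting for logarithms. -/
lemma log_of_homotopy {X : Type*} [TopologicalSpace X] (H : X → ℝ → ℂ)
    (hH : ContinuousOn (fun q : X × ℝ => H q.1 q.2) (univ ×ˢ Icc 0 1))
    (h0 : ∀ x, H x 0 = 1) (hne : ∀ x, ∀ t ∈ Icc (0:ℝ) 1, H x t ≠ 0) :
    ∃ L : X → ℂ, Continuous L ∧ ∀ x, Complex.exp (L x) = H x 1 := by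
  let G : C(unitInterval × X, {z : ℂ // z ≠ 0}) :=
    ⟨fun q => ⟨H q.2 q.1, hne _ _ q.1.2⟩, by
      refine Continuous.subtype_mk ?_ _
      exact hH.comp_continuous (f := fun q : unitInterval × X => (q.2, (q.1 : ℝ)))
        (by fun_prop) (fun q => ⟨mem_univ _, q.1.2⟩)⟩
  have hG0 : ∀ a : X, G (0, a) = (fun z : ℂ ↦ (⟨_, z.exp_ne_zero⟩ : {z : ℂ // z ≠ 0}))
      ((ContinuousMap.const X (0:ℂ)) a) := by
    intro a
    apply Subtype.ext
    simp [G, h0]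
  let F := Complex.isCoveringMap_exp.liftHomotopy G (ContinuousMap.const X 0) hG0
  have hF := Complex.isCoveringMap_exp.liftHomotopy_lifts G (ContinuousMap.const X 0) hG0
  refine ⟨fun x => F (1, x), by fun_prop, fun x => ?_⟩
  have := congrArg Subtype.val (congrFun hF (1, x))
  exact this

/-- A nonvanishing continuous function on a real vector space has a continuous logarithm. -/
lemma log_of_contractible {X : Type*} [NormedAddCommGroup X] [NormedSpace ℝ X] (f : X → ℂ)
    (hf : Continuous f) (hne : ∀ x, f x ≠ 0) :
    ∃ L : X → ℂ, Continuous L ∧ ∀ x, Complex.exp (L x) = f x := by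
  obtain ⟨L, hL, hL'⟩ := log_of_homotopy (fun (x : X) (t : ℝ) => f (t • x) / f 0)
    (by fun_prop) (by simp [hne]) (fun x t _ => div_ne_zero (hne _) (hne _))
  refine ⟨fun x => L x + Complex.log (f 0), by fun_prop, fun x => ?_⟩
  rw [Complex.exp_add, hL', Complex.exp_log (hne _)]
  simp [hne]

/-- Two continuous functions with the same exponential on a preconnected set differ
by a constant. -/
lemma const_of_exp_const {X : Type*} [TopologicalSpace X] {s : Set X} (hs : IsPreconnected s)
    (f : X → ℂ) (hf : ContinuousOn f s) (c : ℂ) (hc : ∀ x ∈ s, Complex.exp (f x) = c)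
    {x y : X} (hx : x ∈ s) (hy : y ∈ s) : f x = f y := by
  have h1 : ∀ z ∈ s, ∃ n : ℤ, f z = f x + n * (2 * Real.pi * Complex.I) := by
    intro z hz
    exact Complex.exp_eq_exp_iff_exists_int.1 ((hc z hz).trans (hc x hx).symm)
  let g : X → ℝ := fun z => (f z - f x).im / (2 * Real.pi)
  have hg : ContinuousOn g s :=
    (Complex.continuous_im.comp_continuousOn (hf.sub continuousOn_const)).div_const _
  have hgn : ∀ z ∈ s, ∃ n : ℤ, f z = f x + n * (2 * Real.pi * Complex.I) ∧ g z = n := by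
    intro z hz
    obtain ⟨n, hn⟩ := h1 z hz
    refine ⟨n, hn, ?_⟩
    simp only [g, hn]
    simp
  have himg : (g '' s).Subsingleton := by
    have hp := hs.image g hg
    have hcount : (g '' s).Countable :=
      (countable_range (fun n : ℤ => (n : ℝ))).mono (by
        rintro _ ⟨z, hz, rfl⟩
        obtain ⟨n, _, hn⟩ := hgn z hz
        exact ⟨n, hn.symm⟩)
    by_contra hnt
    rw [not_subsingleton_iff] at hnt
    obtain ⟨a, ha, b, hb, hab⟩ := hnt
    wlog h : a < b generalizing a b
    · exact this b hb a ha hab.symm (lt_of_le_of_ne (not_lt.1 h) hab.symm)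
    · exact (Cardinal.Real.Icc_countable_iff.1 (hcount.mono (hp.Icc_subset ha hb))).not_gt h
  obtain ⟨n, hn, hn'⟩ := hgn y hy
  obtain ⟨m, hm, hm'⟩ := hgn x hx
  have : g x = g y := himg (mem_image_of_mem _ hx) (mem_image_of_mem _ hy)
  rw [hn', hm'] at this
  have h2 : m = n := by exact_mod_cast this
  rw [hn, ← h2, ← hm]

/-- Descent of a function along a curve, combined with Tietze extension. -/
lemma descend (γ L : ℝ → ℂ) (hγ : Continuous γ) (hL : Continuous L) (s t : ℝ)
    (h : ∀ x ∈ Icc s t, ∀ y ∈ Icc s t, γ x = γ y → L x = L y) :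
    ∃ g : ℂ → ℂ, Continuous g ∧ ∀ x ∈ Icc s t, g (γ x) = L x := by
  have hK : IsCompact (γ '' Icc s t) := isCompact_Icc.image hγ
  let π : Icc s t → γ '' Icc s t := fun x => ⟨γ x, mem_image_of_mem _ x.2⟩
  have hπ : Continuous π := by fun_prop
  have hsurj : Function.Surjective π := by
    rintro ⟨_, x, hx, rfl⟩
    exact ⟨⟨x, hx⟩, rfl⟩
  have hq : Topology.IsQuotientMap π := hπ.isClosedMap.isQuotientMap hπ hsurj
  choose σ hσ using hsurj
  let g0 : γ '' Icc s t → ℂ := fun z => L (σ z)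
  have hg0 : ∀ x, g0 (π x) = L x := by
    intro x
    refine h _ (σ _).2 _ x.2 ?_
    exact congrArg Subtype.val (hσ (π x))
  have hc : Continuous g0 := by
    rw [hq.continuous_iff]
    have : g0 ∘ π = fun x : Icc s t => L x := funext hg0
    rw [this]
    fun_prop
  obtain ⟨g, hg⟩ := ContinuousMap.exists_restrict_eq hK.isClosed ⟨g0, hc⟩
  refine ⟨g, g.continuous, fun x hx => ?_⟩
  have := DFunLike.congr_fun hg (π ⟨x, hx⟩)
  simp only [ContinuousMap.restrict_apply, ContinuousMap.coe_mk, hg0] at this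
  exact this

/-- `(z - p) ^ a` near infinity does not extend to a nonvanishing continuous function. -/
lemma no_ext (F : ℂ → ℂ) (hF : Continuous F) (hne : ∀ z, F z ≠ 0) (p : ℂ) (a : ℤ) (R : ℝ)
    (h : ∀ z, R < ‖z - p‖ → F z = (z - p) ^ a) : a = 0 := by
  obtain ⟨L, hL, hL'⟩ := log_of_contractible F hF hne
  set c : ℂ := ((|R| + 1 : ℝ) : ℂ) with hc
  have hc0 : c ≠ 0 := by
    rw [hc]; exact_mod_cast (by positivity : (|R| + 1 : ℝ) ≠ 0)
  have key := const_of_exp_const (X := ℝ) isPreconnected_univ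
    (fun t => L (p + c * Complex.exp (t * Complex.I)) - a * (t * Complex.I))
    (by fun_prop) (c ^ a) (by
      intro t _
      rw [Complex.exp_sub, hL', h, add_sub_cancel_left, mul_zpow, Complex.exp_int_mul]
      · field_simp
      · rw [add_sub_cancel_left, norm_mul, Complex.norm_exp_ofReal_mul_I, hc, Complex.norm_real,
          mul_one, Real.norm_eq_abs, abs_of_pos (by positivity)]
        linarith [le_abs_self R]) (mem_univ 0) (mem_univ (2 * Real.pi))
  simp [Complex.exp_two_pi_mul_I] at key
  have h2 : (a : ℂ) * (2 * Real.pi * Complex.I) = 0 := by linear_combination key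
  simpa using h2

/-- The main nonexistence lemma. -/
lemma no_log (K U : Set ℂ) (hU : IsOpen U) (hUb : Bornology.IsBounded U) (hfr : frontier U ⊆ K)
    (p q : ℂ) (hp : p ∈ U) (hqU : q ∉ U) (hqK : q ∉ K) (a b : ℤ)
    (g : ℂ → ℂ) (hg : Continuous g)
    (h : ∀ z ∈ K, Complex.exp (g z) = (z - p) ^ a * (z - q) ^ b) : a = 0 := by
  classical
  have hcl : ∀ z ∈ closure U, z - q ≠ 0 := by
    intro z hz hzq
    rw [sub_eq_zero] at hzq
    subst hzq
    exact hqK (hfr ⟨hz, by rwa [hU.interior_eq]⟩)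
  obtain ⟨R, hR⟩ := hUb.subset_closedBall p
  refine no_ext (U.piecewise (fun z => Complex.exp (g z) * (z - q) ^ (-b)) (fun z => (z - p) ^ a))
    ?_ ?_ p a R ?_
  · apply continuous_piecewise
    · intro z hz
      rw [h z (hfr hz), mul_assoc, ← zpow_add₀ (hcl z hz.1)]
      simp
    · refine ContinuousOn.mul (by fun_prop) ?_
      refine ContinuousOn.zpow₀ (by fun_prop) _ ?_
      intro z hz
      exact Or.inl (hcl z hz)
    · rw [hU.isClosed_compl.closure_eq]
      refine ContinuousOn.zpow₀ (by fun_prop) _ ?_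
      intro z hz
      left
      intro h0
      rw [sub_eq_zero] at h0
      exact hz (h0 ▸ hp)
  · intro z
    by_cases hz : z ∈ U
    · rw [piecewise_eq_of_mem _ _ _ hz]
      exact mul_ne_zero (Complex.exp_ne_zero _) (zpow_ne_zero _ (hcl z (subset_closure hz)))
    · rw [piecewise_eq_of_notMem _ _ _ hz]
      refine zpow_ne_zero _ (fun h0 => ?_)
      rw [sub_eq_zero] at h0
      exact hz (h0 ▸ hp)
  · intro z hz
    rw [piecewise_eq_of_notMem]
    intro hzU
    have := hR hzU
    rw [Metric.mem_closedBall, dist_eq_norm] at this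
    linarith

/-- The exterior of a disk is preconnected. -/
lemma isPreconnected_exterior (R : ℝ) (hR : 0 < R) : IsPreconnected {z : ℂ | R < ‖z‖} := by
  have h1 : IsPreconnected {z : ℂ | Real.log R < z.re} :=
    (convex_halfSpace_re_gt (Real.log R)).isPreconnected
  have h2 : Complex.exp '' {z : ℂ | Real.log R < z.re} = {z : ℂ | R < ‖z‖} := by
    ext w
    constructor
    · rintro ⟨z, hz, rfl⟩
      simp only [mem_ofPred_eq] at hz ⊢
      rw [Complex.norm_exp]
      exact (Real.log_lt_iff_lt_exp hR).1 hz
    · intro hw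
      simp only [mem_ofPred_eq] at hw
      have hw0 : w ≠ 0 := by
        intro h; rw [h, norm_zero] at hw; linarith
      refine ⟨Complex.log w, ?_, Complex.exp_log hw0⟩
      simp only [mem_ofPred_eq, Complex.log_re]
      exact Real.log_lt_log hR hw
  rw [← h2]
  exact h1.image _ Complex.continuous_exp.continuousOn

/-- The frontier of a component of an open set lies outside of the set. -/
lemma frontier_component (V : Set ℂ) (hV : IsOpen V) (p : ℂ) :
    frontier (connectedComponentIn V p) ⊆ Vᶜ := by
  intro z hz hzV
  have ho : IsOpen (connectedComponentIn V p) := hV.connectedComponentIn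
  rw [frontier, ho.interior_eq] at hz
  obtain ⟨w, hw1, hw2⟩ := mem_closure_iff.1 hz.1 _ (hV.connectedComponentIn (x := z))
    (mem_connectedComponentIn hzV)
  have h1 := connectedComponentIn_eq hw1
  have h2 := connectedComponentIn_eq hw2
  exact hz.2 (h2.trans h1.symm ▸ mem_connectedComponentIn hzV)

/-- If an open set has no bounded components (and bounded complement), it is preconnected. -/
lemma exists_unbounded_component (K : Set ℂ) (hK : IsCompact K) :
    ∃ w ∈ Kᶜ, ¬ Bornology.IsBounded (connectedComponentIn Kᶜ w) ∧
      ∀ p ∈ Kᶜ, p ∉ connectedComponentIn Kᶜ w →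
        Bornology.IsBounded (connectedComponentIn Kᶜ p) := by
  obtain ⟨R, hR0, hR⟩ := hK.isBounded.subset_closedBall_lt 0 0
  have hsub : {z : ℂ | R < ‖z‖} ⊆ Kᶜ := by
    intro z hz hzK
    have := hR hzK
    simp only [Metric.mem_closedBall, dist_zero_right, mem_ofPred_eq] at this hz
    linarith
  have hw : ((R + 1 : ℝ) : ℂ) ∈ {z : ℂ | R < ‖z‖} := by
    simp only [mem_ofPred_eq, Complex.norm_real, Real.norm_eq_abs]
    linarith [le_abs_self (R + 1)]
  have hcomp := (isPreconnected_exterior R hR0).subset_connectedComponentIn hw hsub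
  refine ⟨_, hsub hw, ?_, ?_⟩
  · intro hb
    obtain ⟨M, hM⟩ := (hb.subset hcomp).subset_closedBall 0
    have : ((|M| + R + 1 : ℝ) : ℂ) ∈ {z : ℂ | R < ‖z‖} := by
      simp only [mem_ofPred_eq, Complex.norm_real, Real.norm_eq_abs]
      linarith [le_abs_self (|M| + R + 1), abs_nonneg M]
    have := hM this
    simp only [Metric.mem_closedBall, dist_zero_right, Complex.norm_real,
      Real.norm_eq_abs] at this
    linarith [le_abs_self (|M| + R + 1), le_abs_self M]
  · intro p hp hpw
    refine (Metric.isBounded_closedBall (x := (0 : ℂ)) (r := R)).subset ?_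
    intro z hz
    simp only [Metric.mem_closedBall, dist_zero_right]
    by_contra hlt
    have h1 := connectedComponentIn_eq (hcomp (not_le.1 hlt))
    have h2 := connectedComponentIn_eq hz
    exact hpw (h1 ▸ h2 ▸ mem_connectedComponentIn hp)


/-- Arcs do not separate. -/
lemma arc_compl (γ : ℝ → ℂ) (hγ : Continuous γ) (s t : ℝ) (hst : s ≤ t)
    (hinj : InjOn γ (Icc s t)) : IsPreconnected (γ '' Icc s t)ᶜ := by
  have hK : IsCompact (γ '' Icc s t) := isCompact_Icc.image hγ
  obtain ⟨w, hw, hwb, hall⟩ := exists_unbounded_component _ hK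
  suffices h : (γ '' Icc s t)ᶜ ⊆ connectedComponentIn (γ '' Icc s t)ᶜ w by
    rw [h.antisymm (connectedComponentIn_subset _ _)]
    exact isPreconnected_connectedComponentIn
  intro p hp
  by_contra hpw
  have hb := hall p hp hpw
  have hproj : ∀ x, max s (min x t) ∈ Icc s t := fun x =>
    ⟨le_max_left _ _, max_le hst (min_le_right _ _)⟩
  obtain ⟨L, hL, hL'⟩ := log_of_contractible (fun x : ℝ => γ (max s (min x t)) - p)
    (by fun_prop) (fun x h0 => hp ⟨_, hproj x, sub_eq_zero.1 h0⟩)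
  obtain ⟨g, hg, hg'⟩ := descend γ L hγ hL s t (fun x hx y hy hxy => by rw [hinj hx hy hxy])
  have := no_log (γ '' Icc s t) (connectedComponentIn (γ '' Icc s t)ᶜ p)
    hK.isClosed.isOpen_compl.connectedComponentIn hb
    (by simpa using frontier_component _ hK.isClosed.isOpen_compl p) p w
    (mem_connectedComponentIn hp) (fun hwp => by
      have := connectedComponentIn_eq hwp
      exact hpw (this ▸ mem_connectedComponentIn hp)) hw 1 0 g hg (by
      rintro _ ⟨x, hx, rfl⟩
      rw [hg' x hx, hL', min_eq_left hx.2, max_eq_right hx.1]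
      simp)
  exact one_ne_zero this

lemma inj_arc (γ : ℝ → ℂ) (hper : ∀ x y, γ x = γ y ↔ ∃ n : ℤ, x - y = n) (s t : ℝ)
    (h : t < s + 1) : InjOn γ (Icc s t) := by
  intro x hx y hy hxy
  obtain ⟨n, hn⟩ := (hper x y).1 hxy
  have h1 : (n : ℝ) < 1 := by linarith [hx.2, hy.1]
  have h2 : (-1 : ℝ) < n := by linarith [hx.1, hy.2]
  have h3 : n < 1 := by exact_mod_cast h1
  have h4 : -1 < n := by exact_mod_cast h2
  have : n = 0 := by lia
  subst this
  simp at hn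
  linarith

lemma range_eq (γ : ℝ → ℂ) (hper : ∀ x y, γ x = γ y ↔ ∃ n : ℤ, x - y = n) (s : ℝ) (z : ℂ)
    (hz : z ∈ range γ) : ∃ y, s ≤ y ∧ y < s + 1 ∧ γ y = z := by
  obtain ⟨x, rfl⟩ := hz
  refine ⟨x - ⌊x - s⌋, by linarith [Int.floor_le (x - s)], by linarith [Int.lt_floor_add_one (x - s)],
    (hper _ _).2 ⟨-⌊x - s⌋, by push_cast; ring⟩⟩

lemma range_eq_image (γ : ℝ → ℂ) (hper : ∀ x y, γ x = γ y ↔ ∃ n : ℤ, x - y = n) :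
    range γ = γ '' Icc 0 1 := by
  apply Subset.antisymm _ (image_subset_range _ _)
  intro z hz
  obtain ⟨y, h1, h2, h3⟩ := range_eq γ hper 0 z hz
  exact ⟨y, ⟨h1, by linarith⟩, h3⟩

/-- At most one bounded component. -/
lemma bounded_unique (γ : ℝ → ℂ) (hγ : Continuous γ)
    (hper : ∀ x y, γ x = γ y ↔ ∃ n : ℤ, x - y = n) (p q : ℂ) (hp : p ∈ (range γ)ᶜ)
    (hq : q ∈ (range γ)ᶜ) (hpb : Bornology.IsBounded (connectedComponentIn (range γ)ᶜ p))
    (hqb : Bornology.IsBounded (connectedComponentIn (range γ)ᶜ q)) :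
    q ∈ connectedComponentIn (range γ)ᶜ p := by
  have hK : IsCompact (range γ) := by
    rw [range_eq_image γ hper]; exact isCompact_Icc.image hγ
  by_contra hqp
  have hpq : p ∉ connectedComponentIn (range γ)ᶜ q := fun h => by
    have := connectedComponentIn_eq h
    exact hqp (this ▸ mem_connectedComponentIn hq)
  have hnep : ∀ x, γ x - p ≠ 0 := fun x h0 => hp ⟨x, sub_eq_zero.1 h0⟩
  have hneq : ∀ x, γ x - q ≠ 0 := fun x h0 => hq ⟨x, sub_eq_zero.1 h0⟩
  obtain ⟨P, hP, hP'⟩ := log_of_contractible (fun x : ℝ => γ x - p) (by fun_prop) hnep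
  obtain ⟨Q, hQ, hQ'⟩ := log_of_contractible (fun x : ℝ => γ x - q) (by fun_prop) hneq
  have h01 : γ 1 = γ 0 := (hper 1 0).2 ⟨1, by simp⟩
  obtain ⟨m, hm⟩ := Complex.exp_eq_exp_iff_exists_int.1
    (show Complex.exp (P 1) = Complex.exp (P 0) by rw [hP', hP', h01])
  obtain ⟨n, hn⟩ := Complex.exp_eq_exp_iff_exists_int.1
    (show Complex.exp (Q 1) = Complex.exp (Q 0) by rw [hQ', hQ', h01])
  have hex : ∀ a b : ℤ, a * m + b * n = 0 → ∃ g : ℂ → ℂ, Continuous g ∧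
      ∀ z ∈ range γ, Complex.exp (g z) = (z - p) ^ a * (z - q) ^ b := by
    intro a b hab
    have hab' : (a : ℂ) * m + b * n = 0 := by exact_mod_cast hab
    have e01 : (a : ℂ) * P 1 + b * Q 1 = a * P 0 + b * Q 0 := by
      rw [hm, hn]
      linear_combination (2 * Real.pi * Complex.I) * hab'
    obtain ⟨g, hg, hg'⟩ := descend γ (fun x => a * P x + b * Q x) hγ (by fun_prop) 0 1 (by
      intro x hx y hy hxy
      obtain ⟨k, hk⟩ := (hper x y).1 hxy
      have h1 : (k : ℝ) ≤ 1 := by linarith [hx.2, hy.1]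
      have h2 : (-1 : ℝ) ≤ k := by linarith [hx.1, hy.2]
      have h3 : k ≤ 1 := by exact_mod_cast h1
      have h4 : -1 ≤ k := by exact_mod_cast h2
      obtain rfl | rfl | rfl : k = -1 ∨ k = 0 ∨ k = 1 := by lia
      · push_cast at hk
        obtain rfl : x = 0 := by linarith [hx.1, hy.2]
        obtain rfl : y = 1 := by linarith
        exact e01.symm
      · push_cast at hk
        obtain rfl : x = y := by linarith
        rfl
      · push_cast at hk
        obtain rfl : y = 0 := by linarith [hx.2, hy.1]
        obtain rfl : x = 1 := by linarith
        exact e01)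
    refine ⟨g, hg, ?_⟩
    rw [range_eq_image γ hper]
    rintro _ ⟨x, hx, rfl⟩
    rw [hg' x hx, Complex.exp_add, Complex.exp_int_mul, Complex.exp_int_mul, hP', hQ']
  have hoc := hK.isClosed.isOpen_compl
  have nlp := no_log (range γ) (connectedComponentIn (range γ)ᶜ p) hoc.connectedComponentIn hpb
    (by simpa using frontier_component _ hoc p) p q (mem_connectedComponentIn hp) hqp hq
  have nlq := no_log (range γ) (connectedComponentIn (range γ)ᶜ q) hoc.connectedComponentIn hqb
    (by simpa using frontier_component _ hoc q) q p (mem_connectedComponentIn hq) hpq hp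
  obtain ⟨g, hg, hg'⟩ := hex n (-m) (by ring)
  have hn0 : n = 0 := nlp n (-m) g hg hg'
  have hm0 : -m = 0 := nlq (-m) n g hg (fun z hz => by rw [hg' z hz, mul_comm])
  have hm1 : m = 0 := by lia
  obtain ⟨g, hg, hg'⟩ := hex 1 0 (by simp [hm1])
  have hone := nlp 1 0 g hg hg'
  exact one_ne_zero hone

/-- A logarithm on the complement of an arc. -/
lemma log_compl_arc (γ : ℝ → ℂ) (hγ : Continuous γ) (s t : ℝ) (hst : s ≤ t) :
    ∃ l : ℂ → ℂ, ContinuousOn l (γ '' Icc s t)ᶜ ∧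
      ∀ z ∈ (γ '' Icc s t)ᶜ, Complex.exp (l z) = (z - γ s) / (z - γ t) := by
  classical
  have hmem : ∀ u ∈ Icc (0:ℝ) 1, s + u * (t - s) ∈ Icc s t := by
    intro u hu
    constructor
    · nlinarith [hu.1]
    · nlinarith [hu.2]
  have hne : ∀ z : ↥(γ '' Icc s t)ᶜ, ∀ u ∈ Icc (0:ℝ) 1, (z : ℂ) - γ (s + u * (t - s)) ≠ 0 := by
    intro z u hu h0
    exact z.2 ⟨_, hmem u hu, (sub_eq_zero.1 h0).symm⟩
  have hnes : ∀ z : ↥(γ '' Icc s t)ᶜ, (z : ℂ) - γ s ≠ 0 := by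
    intro z
    have := hne z 0 (by simp)
    simpa using this
  obtain ⟨L, hL, hL'⟩ := log_of_homotopy
    (fun (z : ↥(γ '' Icc s t)ᶜ) (u : ℝ) => ((z : ℂ) - γ s) / ((z : ℂ) - γ (s + u * (t - s))))
    (by
      refine ContinuousOn.div (by fun_prop) (by fun_prop) ?_
      rintro ⟨z, u⟩ ⟨_, hu⟩
      exact hne z u hu)
    (by
      intro z
      simp [hnes z])
    (fun z u hu => div_ne_zero (hnes z) (hne z u hu))
  refine ⟨fun z => if h : z ∈ (γ '' Icc s t)ᶜ then L ⟨z, h⟩ else 0, ?_, ?_⟩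
  · rw [continuousOn_iff_continuous_domRestrict]
    convert hL using 1
    ext z
    have := z.2
    simp only [domRestrict_apply, dif_pos this]
  · intro z hz
    have hres := hL' ⟨z, hz⟩
    simp only [dif_pos hz, hres]
    simp

/-- No logarithm of `(z - a) / (z - b)` on the plane minus two points. -/
lemma no_log_two (a b : ℂ) (hab : a ≠ b) (l : ℂ → ℂ) (hl : ContinuousOn l {z | z ≠ a ∧ z ≠ b})
    (h : ∀ z, z ≠ a → z ≠ b → Complex.exp (l z) = (z - a) / (z - b)) : False := by
  have hba : b - a ≠ 0 := sub_ne_zero.2 hab.symm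
  set c : ℂ := ((‖b - a‖ / 2 : ℝ) : ℂ) with hc
  have hr : 0 < ‖b - a‖ := norm_pos_iff.2 hba
  have hc0 : c ≠ 0 := by
    rw [hc]; exact_mod_cast (by positivity : (‖b - a‖ / 2 : ℝ) ≠ 0)
  have hcn : ‖c‖ = ‖b - a‖ / 2 := by
    rw [hc, Complex.norm_real, Real.norm_eq_abs, abs_of_pos (by positivity)]
  have hz1 : ∀ t : ℝ, a + c * Complex.exp (t * Complex.I) ≠ a := by
    intro t h0
    have : c * Complex.exp (t * Complex.I) = 0 := by linear_combination h0
    simp [hc0] at this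
  have hz2 : ∀ t : ℝ, a + c * Complex.exp (t * Complex.I) ≠ b := by
    intro t h0
    have h1 : c * Complex.exp (t * Complex.I) = b - a := by linear_combination h0
    have := congrArg norm h1
    rw [norm_mul, Complex.norm_exp_ofReal_mul_I, mul_one, hcn] at this
    linarith
  have hsl : ∀ t : ℝ, 1 + -(c * Complex.exp (t * Complex.I) / (b - a)) ∈ Complex.slitPlane := by
    intro t
    apply Complex.mem_slitPlane_of_norm_lt_one
    rw [norm_neg, norm_div, norm_mul, Complex.norm_exp_ofReal_mul_I, mul_one, hcn,
      div_lt_one hr]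
    linarith
  have key := const_of_exp_const (X := ℝ) isPreconnected_univ
    (fun t => l (a + c * Complex.exp (t * Complex.I)) +
      Complex.log (1 + -(c * Complex.exp (t * Complex.I) / (b - a))) - t * Complex.I)
    (by
      refine ContinuousOn.sub (ContinuousOn.add ?_ ?_) (by fun_prop)
      · exact hl.comp (by fun_prop) (fun t _ => ⟨hz1 t, hz2 t⟩)
      · exact ContinuousOn.clog (by fun_prop) (fun t _ => hsl t))
    (c / (a - b)) (by
      intro t _
      rw [Complex.exp_sub, Complex.exp_add, h _ (hz1 t) (hz2 t),
        Complex.exp_log (Complex.slitPlane_ne_zero (hsl t))]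
      have h1 : a + c * Complex.exp (t * Complex.I) - b ≠ 0 := sub_ne_zero.2 (hz2 t)
      have h2 : a - b ≠ 0 := sub_ne_zero.2 hab
      have h3 := Complex.exp_ne_zero (t * Complex.I)
      field_simp
      ring) (mem_univ 0) (mem_univ (2 * Real.pi))
  simp [Complex.exp_two_pi_mul_I] at key
  have h2 : (2 * Real.pi * Complex.I : ℂ) = 0 := by linear_combination key
  simp at h2

/-- A Jordan curve separates the plane. -/
lemma separates (γ : ℝ → ℂ) (hγ : Continuous γ)
    (hper : ∀ x y, γ x = γ y ↔ ∃ n : ℤ, x - y = n) : ¬ IsPreconnected (range γ)ᶜ := by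
  classical
  intro hpre
  obtain ⟨l₁, hl₁, hl₁'⟩ := log_compl_arc γ hγ 0 (1/2) (by norm_num)
  obtain ⟨l₂, hl₂, hl₂'⟩ := log_compl_arc γ hγ (1/2) 1 (by norm_num)
  have h01 : γ 1 = γ 0 := (hper 1 0).2 ⟨1, by simp⟩
  rw [h01] at hl₂'
  have hab : γ 0 ≠ γ (1/2) := by
    intro h
    have := inj_arc γ hper 0 (1/2) (by norm_num) (by simp) (by simp) h
    norm_num at this
  set A := γ '' Icc 0 (1/2) with hA
  set B := γ '' Icc (1/2) 1 with hB
  have hAo : IsOpen Aᶜ := (isCompact_Icc.image hγ).isClosed.isOpen_compl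
  have hBo : IsOpen Bᶜ := (isCompact_Icc.image hγ).isClosed.isOpen_compl
  have hAB : (range γ)ᶜ = Aᶜ ∩ Bᶜ := by
    rw [range_eq_image γ hper, ← compl_union, hA, hB, ← image_union,
      Icc_union_Icc_eq_Icc (by norm_num) (by norm_num)]
  have hcov : ∀ z, z ≠ γ 0 → z ≠ γ (1/2) → z ∈ Aᶜ ∨ z ∈ Bᶜ := by
    intro z hz0 hz1
    by_contra hcon
    push Not at hcon
    obtain ⟨hzA, hzB⟩ := hcon
    rw [notMem_compl_iff] at hzA hzB
    obtain ⟨x, hx, rfl⟩ := hzA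
    obtain ⟨y, hy, hxy⟩ := hzB
    obtain ⟨k, hk⟩ := (hper y x).1 hxy
    have h1 : (k : ℝ) ≤ 1 := by linarith [hx.1, hy.2]
    have h2 : (0 : ℝ) ≤ k := by linarith [hx.2, hy.1]
    have h3 : k ≤ 1 := by exact_mod_cast h1
    have h4 : 0 ≤ k := by exact_mod_cast h2
    obtain rfl | rfl : k = 0 ∨ k = 1 := by lia
    · push_cast at hk
      obtain rfl : x = 1/2 := by linarith [hx.2, hy.1]
      exact hz1 rfl
    · push_cast at hk
      obtain rfl : x = 0 := by linarith [hx.1, hy.2]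
      exact hz0 rfl
  obtain ⟨c, hc1, hc⟩ : ∃ c : ℂ, Complex.exp c = 1 ∧ ∀ z ∈ Aᶜ ∩ Bᶜ, l₁ z = - l₂ z + c := by
    rw [hAB] at hpre
    have hexp : ∀ z ∈ Aᶜ ∩ Bᶜ, Complex.exp (l₁ z + l₂ z) = 1 := by
      rintro z ⟨hzA, hzB⟩
      have h1 : z - γ 0 ≠ 0 := fun h0 => hzA ⟨0, by simp, (sub_eq_zero.1 h0).symm⟩
      have h2 : z - γ (1/2) ≠ 0 := fun h0 => hzA ⟨1/2, by simp, (sub_eq_zero.1 h0).symm⟩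
      rw [Complex.exp_add, hl₁' z hzA, hl₂' z hzB]
      field_simp
    by_cases hne : (Aᶜ ∩ Bᶜ).Nonempty
    · obtain ⟨w, hw⟩ := hne
      refine ⟨l₁ w + l₂ w, hexp w hw, fun z hz => ?_⟩
      have := const_of_exp_const hpre (fun z => l₁ z + l₂ z)
        ((hl₁.mono inter_subset_left).add (hl₂.mono inter_subset_right)) 1 hexp hz hw
      linear_combination this
    · exact ⟨0, by simp, fun z hz => absurd ⟨z, hz⟩ hne⟩
  refine no_log_two (γ 0) (γ (1/2)) hab (fun z => if z ∈ Aᶜ then l₁ z else - l₂ z + c) ?_ ?_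
  · rintro z ⟨hz0, hz1⟩
    apply ContinuousAt.continuousWithinAt
    rcases hcov z hz0 hz1 with hz | hz
    · refine (hl₁.continuousAt (hAo.mem_nhds hz)).congr ?_
      filter_upwards [hAo.mem_nhds hz] with y hy
      rw [if_pos hy]
    · refine (((hl₂.continuousAt (hBo.mem_nhds hz)).neg).add continuousAt_const).congr
        (f := fun z => - l₂ z + c) ?_
      filter_upwards [hBo.mem_nhds hz] with y hy
      split_ifs with hyA
      · rw [hc y ⟨hyA, hy⟩]
      · rfl
  · intro z hz0 hz1
    split_ifs with hz
    · exact hl₁' z hz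
    · have hzB := (hcov z hz0 hz1).resolve_left hz
      rw [Complex.exp_add, Complex.exp_neg, hl₂' z hzB, hc1, mul_one, inv_div]

/-- The frontier of each component is the whole curve. -/
lemma frontier_eq (γ : ℝ → ℂ) (hγ : Continuous γ)
    (hper : ∀ x y, γ x = γ y ↔ ∃ n : ℤ, x - y = n) (p : ℂ) (hp : p ∈ (range γ)ᶜ) :
    frontier (connectedComponentIn (range γ)ᶜ p) = range γ := by
  have hK : IsCompact (range γ) := by
    rw [range_eq_image γ hper]; exact isCompact_Icc.image hγ
  have hoc := hK.isClosed.isOpen_compl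
  have hsub : frontier (connectedComponentIn (range γ)ᶜ p) ⊆ range γ := by
    simpa using frontier_component _ hoc p
  refine hsub.antisymm ?_
  rintro _ ⟨τ, rfl⟩
  by_contra hτ
  have hopen : IsOpen (γ ⁻¹' (frontier (connectedComponentIn (range γ)ᶜ p))ᶜ) :=
    isClosed_frontier.isOpen_compl.preimage hγ
  obtain ⟨ε, hε, hball⟩ := Metric.isOpen_iff.1 hopen τ hτ
  obtain ⟨δ, hδ0, hδε, hδ1⟩ : ∃ δ : ℝ, 0 < δ ∧ δ < ε ∧ δ < 1/2 :=
    ⟨min (ε/2) (1/4), by positivity, (min_le_left _ _).trans_lt (by linarith),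
      (min_le_right _ _).trans_lt (by norm_num)⟩
  have hfr : frontier (connectedComponentIn (range γ)ᶜ p) ⊆ γ '' Icc (τ + δ) (τ + 1 - δ) := by
    intro z hz
    obtain ⟨y, h1, h2, rfl⟩ := range_eq γ hper (τ - δ) z (hsub hz)
    refine ⟨y, ⟨?_, by linarith⟩, rfl⟩
    by_contra hy
    push Not at hy
    suffices hyb : y ∈ Metric.ball τ ε from hball hyb hz
    rw [Metric.mem_ball, Real.dist_eq, abs_lt]
    constructor <;> linarith
  have hpre := arc_compl γ hγ (τ + δ) (τ + 1 - δ) (by linarith)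
    (inj_arc γ hper _ _ (by linarith))
  have hpU := mem_connectedComponentIn hp
  have hss := hpre.subset_of_closure_inter_subset (u := connectedComponentIn (range γ)ᶜ p)
    hoc.connectedComponentIn ⟨p, fun ⟨x, _, hx⟩ => hp ⟨x, hx⟩, hpU⟩ (by
      rintro z ⟨hz1, hz2⟩
      by_contra hz3
      exact hz2 (hfr ⟨hz1, by rwa [hoc.connectedComponentIn.interior_eq]⟩))
  have hmem : γ τ ∈ (γ '' Icc (τ + δ) (τ + 1 - δ))ᶜ := by
    rintro ⟨y, hy, hyτ⟩
    obtain ⟨n, hn⟩ := (hper _ _).1 hyτ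
    have h1 : (n : ℝ) < 1 := by linarith [hy.2]
    have h2 : (0 : ℝ) < n := by linarith [hy.1]
    have h3 : n < 1 := by exact_mod_cast h1
    have h4 : 0 < n := by exact_mod_cast h2
    lia
  exact connectedComponentIn_subset _ _ (hss hmem) ⟨τ, rfl⟩

/-- The Jordan curve theorem in the complex plane. -/
lemma jordan_complex (γ : ℝ → ℂ) (hγ : Continuous γ)
    (hper : ∀ x y, γ x = γ y ↔ ∃ n : ℤ, x - y = n) :
    ∃ A B : Set ℂ, IsConnected A ∧ IsConnected B ∧ IsOpen A ∧ IsOpen B ∧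
      A ∩ B = ∅ ∧ A ∪ B = (range γ)ᶜ ∧
      Bornology.IsBounded A ∧ ¬ Bornology.IsBounded B ∧
      frontier A = range γ ∧ frontier B = range γ := by
  have hK : IsCompact (range γ) := by
    rw [range_eq_image γ hper]; exact isCompact_Icc.image hγ
  have hoc := hK.isClosed.isOpen_compl
  obtain ⟨w, hw, hwb, hall⟩ := exists_unbounded_component _ hK
  obtain ⟨p, hp, hpw⟩ : ∃ p ∈ (range γ)ᶜ, p ∉ connectedComponentIn (range γ)ᶜ w := by
    by_contra hcon
    push Not at hcon
    apply separates γ hγ hper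
    rw [Subset.antisymm (show (range γ)ᶜ ⊆ _ from hcon) (connectedComponentIn_subset _ _)]
    exact isPreconnected_connectedComponentIn
  refine ⟨connectedComponentIn (range γ)ᶜ p, connectedComponentIn (range γ)ᶜ w,
    isConnected_connectedComponentIn_iff.2 hp, isConnected_connectedComponentIn_iff.2 hw,
    hoc.connectedComponentIn, hoc.connectedComponentIn, ?_, ?_, hall p hp hpw, hwb,
    frontier_eq γ hγ hper p hp, frontier_eq γ hγ hper w hw⟩
  · rw [eq_empty_iff_forall_notMem]
    rintro z ⟨hz1, hz2⟩
    have h1 := connectedComponentIn_eq hz1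
    have h2 := connectedComponentIn_eq hz2
    exact hpw (h2.trans h1.symm ▸ mem_connectedComponentIn hp)
  · apply Subset.antisymm
    · exact union_subset (connectedComponentIn_subset _ _) (connectedComponentIn_subset _ _)
    · intro q hq
      by_cases hqw : q ∈ connectedComponentIn (range γ)ᶜ w
      · exact Or.inr hqw
      · exact Or.inl (bounded_unique γ hγ hper p q hp hq (hall p hp hpw) (hall q hq hqw))

end JordanAux

/-- Jordan curve theorem: the complement of a Jordan curve in the plane has exactly two
connected components, one bounded and one unbounded, and the curve is the boundary of
each of them. -/
theorem jordan_curve_theorem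
    (C : Set Plane) (hC : Nonempty (↥unitCircle ≃ₜ ↥C)) :
    ∃ A B : Set Plane,
      IsConnected A ∧ IsConnected B ∧ IsOpen A ∧ IsOpen B ∧
      A ∩ B = ∅ ∧ A ∪ B = Cᶜ ∧
      Bornology.IsBounded A ∧ ¬ Bornology.IsBounded B ∧
      frontier A = C ∧ frontier B = C := by
  obtain ⟨φ⟩ := hC
  let e : ℂ ≃ₗᵢ[ℝ] Plane := Complex.orthonormalBasisOneI.repr
  let c : ℝ → unitCircle := fun t => ⟨e (Complex.exp ((2 * Real.pi * t : ℝ) * Complex.I)), by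
    rw [mem_sphere_zero_iff_norm, e.norm_map, Complex.norm_exp_ofReal_mul_I]⟩
  have hc : Continuous c := by
    refine Continuous.subtype_mk ?_ _
    exact e.continuous.comp (by fun_prop)
  have hcs : Function.Surjective c := by
    rintro ⟨v, hv⟩
    rw [mem_sphere_zero_iff_norm] at hv
    have hn : ‖e.symm v‖ = 1 := by rw [e.symm.norm_map, hv]
    refine ⟨(e.symm v).arg / (2 * Real.pi), Subtype.ext ?_⟩
    have h1 := Complex.norm_mul_exp_arg_mul_I (e.symm v)
    rw [hn, Complex.ofReal_one, one_mul] at h1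
    have h2 : 2 * Real.pi * ((e.symm v).arg / (2 * Real.pi)) = (e.symm v).arg := by
      field_simp
    simp only [c, h2, h1]
    exact e.apply_symm_apply v
  have hper0 : ∀ x y, c x = c y ↔ ∃ n : ℤ, x - y = n := by
    intro x y
    have hpi : (2 * Real.pi : ℂ) * Complex.I ≠ 0 := by simp
    rw [Subtype.ext_iff]
    simp only [c]
    rw [e.injective.eq_iff, Complex.exp_eq_exp_iff_exists_int]
    refine exists_congr fun n => ?_
    constructor
    · intro h
      have h' : ((x - y - n : ℝ) : ℂ) * ((2 * Real.pi : ℂ) * Complex.I) = 0 := by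
        push_cast at h ⊢
        linear_combination h
      have := (mul_eq_zero.1 h').resolve_right hpi
      have : x - y - n = 0 := by exact_mod_cast this
      linarith
    · intro h
      have : x = y + n := by linarith
      rw [this]
      push_cast
      ring
  let γ : ℝ → ℂ := fun t => e.symm (φ (c t))
  have hγ : Continuous γ :=
    e.symm.continuous.comp (continuous_subtype_val.comp (φ.continuous.comp hc))
  have hper : ∀ x y, γ x = γ y ↔ ∃ n : ℤ, x - y = n := by
    intro x y
    rw [← hper0]
    simp only [γ]
    rw [e.symm.injective.eq_iff, Subtype.val_injective.eq_iff, φ.injective.eq_iff]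
  have hr : e '' range γ = C := by
    ext v
    constructor
    · rintro ⟨_, ⟨t, rfl⟩, rfl⟩
      simp only [γ, e.apply_symm_apply]
      exact (φ (c t)).2
    · intro hv
      obtain ⟨u, hu⟩ := φ.surjective ⟨v, hv⟩
      obtain ⟨t, rfl⟩ := hcs u
      refine ⟨_, ⟨t, rfl⟩, ?_⟩
      simp only [γ, hu, e.apply_symm_apply]
  obtain ⟨A, B, hA, hB, hAo, hBo, hAB, hU, hAb, hBb, hfA, hfB⟩ :=
    JordanAux.jordan_complex γ hγ hper
  have him : ∀ S : Set ℂ, frontier (e '' S) = e '' frontier S := fun S =>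
    (e.toHomeomorph.image_frontier S).symm
  have hop : ∀ S : Set ℂ, IsOpen S → IsOpen (e '' S) := fun S hS =>
    e.toHomeomorph.isOpenMap S hS
  refine ⟨e '' A, e '' B, hA.image _ e.continuous.continuousOn,
    hB.image _ e.continuous.continuousOn, hop _ hAo, hop _ hBo, ?_, ?_, ?_, ?_, ?_, ?_⟩
  · rw [← image_inter e.injective, hAB, image_empty]
  · rw [← image_union, hU, image_compl_eq e.bijective, hr]
  · exact e.lipschitz.isBounded_image hAb
  · intro hb
    apply hBb
    have := e.symm.lipschitz.isBounded_image hb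
    rwa [← image_comp, show (e.symm ∘ e : ℂ → ℂ) = id from funext e.symm_apply_apply,
      image_id] at this
  · rw [him, hfA, hr]
  · rw [him, hfB, hr]
end

section
/- If C ⊆ ℝ² is homeomorphic to the unit circle, then every point of C is locally connectedly accessible both from the bounded component B(C) of ℝ² \ C and from the unbounded component ℝ² \ (B(C) ∪ C). -/
open Set

/-- `x` is locally connectedly accessible from `A`. -/
def LocConnAccess {X : Type*} [TopologicalSpace X] (A : Set X) (x : X) : Prop :=
  ∀ U : Set X, IsOpen U → x ∈ U → ∃ G : Set X, IsOpen G ∧ x ∈ G ∧ G ⊆ U ∧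
    ∀ u ∈ G ∩ A, ∀ v ∈ G ∩ A, ∃ E : Set X, IsConnected E ∧ u ∈ E ∧ v ∈ E ∧ E ⊆ U ∩ A



lemma JA_diff_const {X : Type*} [TopologicalSpace X] {S : Set X} (hS : IsPreconnected S)
    {f g : X → ℂ} (hf : ContinuousOn f S) (hg : ContinuousOn g S)
    (h : ∀ x ∈ S, Complex.exp (f x) = Complex.exp (g x)) {x y : X} (hx : x ∈ S) (hy : y ∈ S) :
    f x - g x = f y - g y := by
  have key : ∀ z ∈ S, ∃ n : ℤ, f z - g z = n * (2 * Real.pi * Complex.I) := by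
    intro z hz
    obtain ⟨n, hn⟩ := Complex.exp_eq_exp_iff_exists_int.1 (h z hz)
    exact ⟨n, by rw [hn]; ring⟩
  have h2 : (2 * Real.pi * Complex.I : ℂ) ≠ 0 := by
    simp [Real.pi_ne_zero]
  have hd : IsDiscrete (range (fun n : ℤ => (n : ℝ))) := by
    rw [isDiscrete_iff_discreteTopology]
    exact Int.isClosedEmbedding_coe_real.isEmbedding.toHomeomorph.symm.isEmbedding.discreteTopology
  have hc : ContinuousOn (fun z => ((f z - g z) / (2 * Real.pi * Complex.I)).re) S :=
    Complex.continuous_re.comp_continuousOn ((hf.sub hg).div_const _)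
  have := hS.constant_of_mapsTo hd hc (by
    intro z hz
    obtain ⟨n, hn⟩ := key z hz
    refine ⟨n, ?_⟩
    simp only
    rw [hn, mul_div_cancel_right₀ _ h2]; simp) hx hy
  obtain ⟨n, hn⟩ := key x hx
  obtain ⟨m, hm⟩ := key y hy
  simp only [hn, hm, mul_div_cancel_right₀ _ h2] at this
  rw [hn, hm]
  simp at this
  rw [this]

lemma JA_lift {X : Type*} [TopologicalSpace X] [SimplyConnectedSpace X]
    [LocallyPathConnectedSpace X] {F : X → ℂ} (hF : Continuous F) (h0 : ∀ x, F x ≠ 0) :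
    ∃ f : X → ℂ, Continuous f ∧ ∀ x, Complex.exp (f x) = F x := by
  obtain ⟨x₀⟩ : Nonempty X := inferInstance
  rcases Complex.isCoveringMapOn_exp.existsUnique_continuousMap_lifts
    ⟨F, hF⟩ (a₀ := x₀) (Complex.exp_log (h0 x₀))
    (fun x ↦ h0 x) with ⟨f, ⟨-, hf⟩, -⟩
  exact ⟨f, f.continuous, fun x => congrFun hf x⟩

/-- `(z-b)^k` outside a bounded open set extends without zeros only if `k = 0`. -/
lemma JA_ext {D : Set ℂ} (hDb : Bornology.IsBounded D) {b : ℂ} {k : ℤ} {F : ℂ → ℂ}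
    (hF : Continuous F) (h0 : ∀ x, F x ≠ 0) (hD : ∀ z ∉ D, F z = (z - b) ^ k) : k = 0 := by
  obtain ⟨f, hf, hfe⟩ := JA_lift hF h0
  obtain ⟨R, hR0, hR⟩ := hDb.subset_ball_lt 0 b
  set c : ℝ → ℂ := fun t => R * Complex.exp (t * Complex.I) with hc
  have hcc : Continuous c := by fun_prop
  have hn : ∀ t, b + c t ∉ D := by
    intro t ht
    have := hR ht
    simp [hc, Complex.norm_exp_ofReal_mul_I, abs_of_pos hR0] at this
  have hRc : (R : ℂ) ≠ 0 := by exact_mod_cast hR0.ne'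
  have := JA_diff_const (X := ℝ) isPreconnected_univ (f := fun t => f (b + c t))
    (g := fun t => k * (Complex.log R + t * Complex.I)) (by fun_prop) (by fun_prop) (by
      intro t _
      rw [hfe, hD _ (hn t), Complex.exp_int_mul, Complex.exp_add, Complex.exp_log hRc]
      simp [hc]) (mem_univ 0) (mem_univ (2 * Real.pi))
  have e : c 0 = c (2 * Real.pi) := by simp [hc]
  simp only [e] at this
  have h3 : (k : ℂ) * (2 * Real.pi * Complex.I) = 0 := by
    push_cast at this
    linear_combination this
  have h2 : (2 * Real.pi * Complex.I : ℂ) ≠ 0 := by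
    simp [Real.pi_ne_zero]
  simpa [h2, Real.pi_ne_zero] using h3

lemma JA_eil {D : Set ℂ} (hDo : IsOpen D) (hDb : Bornology.IsBounded D) {b : ℂ} (hb : b ∈ D)
    {k : ℤ} {r g : ℂ → ℂ} (hr : ContinuousOn r (closure D)) (hr0 : ∀ z ∈ closure D, r z ≠ 0)
    (hg : ContinuousOn g (frontier D))
    (hgr : ∀ z ∈ frontier D, Complex.exp (g z) = (z - b) ^ k * r z) : k = 0 := by
  classical
  obtain ⟨G, hG⟩ := ContinuousMap.exists_restrict_eq isClosed_frontier
    (⟨(frontier D).domRestrict g, continuousOn_iff_continuous_domRestrict.1 hg⟩ : C(frontier D, ℂ))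
  have hG' : ∀ z ∈ frontier D, G z = g z := fun z hz => by
    have := congrArg (fun q => q ⟨z, hz⟩) hG
    exact this
  have hne : ∀ z ∉ D, z - b ≠ 0 := fun z hz h => hz (by rwa [sub_eq_zero.1 h])
  refine JA_ext (D := D) hDb (b := b) (F := D.piecewise (fun z => Complex.exp (G z) / r z)
    (fun z => (z - b) ^ k)) ?_ ?_ ?_
  · apply continuous_piecewise
    · intro z hz
      rw [hG' z hz, hgr z hz, mul_div_cancel_right₀ _ (hr0 z (frontier_subset_closure hz))]
    · exact ContinuousOn.div (by fun_prop) hr hr0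
    · rw [hDo.isClosed_compl.closure_eq]
      exact ContinuousOn.zpow₀ (by fun_prop) _ (fun z hz => Or.inl (hne z hz))
  · intro z
    by_cases hz : z ∈ D
    · simp [hz, hr0 z (subset_closure hz)]
    · simp only [hz, not_false_eq_true, piecewise_eq_of_notMem]
      exact zpow_ne_zero _ (hne z hz)
  · intro z hz
    simp [hz]

/-- nonseparated points have a log -/
lemma JA_log_of_conn {K S : Set ℂ} (hK : IsClosed K) (hS : IsPreconnected S) (hSK : S ⊆ Kᶜ)
    {a b : ℂ} (ha : a ∈ S) (hb : b ∈ S) :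
    ∃ g : ℂ → ℂ, ContinuousOn g K ∧ ∀ z ∈ K, Complex.exp (g z) = (z - a) / (z - b) := by
  set P : ℂ → ℂ → Prop := fun a b =>
    ∃ g : ℂ → ℂ, ContinuousOn g K ∧ ∀ z ∈ K, Complex.exp (g z) = (z - a) / (z - b) with hP
  have hne : ∀ a ∉ K, ∀ z ∈ K, z - a ≠ 0 := fun a ha z hz h => ha (by rwa [← sub_eq_zero.1 h])
  have symm : ∀ a b, P a b → P b a := by
    rintro a b ⟨g, hg, h⟩
    refine ⟨fun z => - g z, hg.neg, fun z hz => ?_⟩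
    rw [Complex.exp_neg, h z hz, inv_div]
  have trans : ∀ a b c, b ∉ K → P a b → P b c → P a c := by
    rintro a b c hbK ⟨g, hg, h⟩ ⟨g', hg', h'⟩
    refine ⟨fun z => g z + g' z, hg.add hg', fun z hz => ?_⟩
    rw [Complex.exp_add, h z hz, h' z hz, div_mul_div_cancel₀ (hne b hbK z hz)]
  have loc : ∀ b ∉ K, ∃ ε > 0, Metric.ball b ε ⊆ Kᶜ ∧ ∀ a ∈ Metric.ball b ε, P a b := by
    intro b hbK
    obtain ⟨ε, he, hε⟩ := Metric.isOpen_iff.1 hK.isOpen_compl b hbK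
    refine ⟨ε, he, hε, fun a ha => ?_⟩
    have hs : ∀ z ∈ K, (z - a) / (z - b) ∈ Complex.slitPlane := by
      intro z hz
      have hz0 := hne b hbK z hz
      have e : (z - a) / (z - b) = 1 + (b - a) / (z - b) := by field_simp; ring
      rw [e]
      apply Complex.mem_slitPlane_of_norm_lt_one
      rw [norm_div, div_lt_one (norm_pos_iff.2 hz0)]
      have h1 : ¬ z ∈ Metric.ball b ε := fun h => hε h hz
      rw [Metric.mem_ball, dist_eq_norm, not_lt] at h1
      rw [Metric.mem_ball, dist_comm, dist_eq_norm] at ha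
      linarith
    refine ⟨fun z => Complex.log ((z - a) / (z - b)), ?_, fun z hz => ?_⟩
    · exact ContinuousOn.clog (ContinuousOn.div (by fun_prop) (by fun_prop) (hne b hbK)) hs
    · exact Complex.exp_log (Complex.slitPlane_ne_zero (hs z hz))
  have o1 : IsOpen {a | a ∉ K ∧ P a b} := by
    rw [Metric.isOpen_iff]
    rintro a ⟨haK, hab⟩
    obtain ⟨ε, he, hε, h⟩ := loc a haK
    exact ⟨ε, he, fun c hc => ⟨hε hc, trans _ _ _ haK (h c hc) hab⟩⟩
  have o2 : IsOpen {a | a ∉ K ∧ ¬ P a b} := by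
    rw [Metric.isOpen_iff]
    rintro a ⟨haK, hab⟩
    obtain ⟨ε, he, hε, h⟩ := loc a haK
    exact ⟨ε, he, fun c hc => ⟨hε hc, fun hcb => hab (trans _ _ _ (hε hc) (symm _ _ (h c hc)) hcb)⟩⟩
  have := hS.subset_left_of_subset_union o1 o2 (by
    rw [Set.disjoint_left]; rintro x ⟨_, h⟩ ⟨_, h'⟩; exact h' h)
    (fun x hx => by
      by_cases h : P x b
      · exact Or.inl ⟨hSK hx, h⟩
      · exact Or.inr ⟨hSK hx, h⟩)
    ⟨b, hb, hSK hb, by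
      refine ⟨fun _ => 0, continuousOn_const, fun z hz => ?_⟩
      rw [Complex.exp_zero, div_self (hne b (hSK hb) z hz)]⟩
  exact (this ha).2

lemma JA_glue {K L : Set ℂ} (hK : IsClosed K) (hL : IsClosed L) (hKL : IsPreconnected (K ∩ L))
    {f g g' : ℂ → ℂ} (hg : ContinuousOn g K) (hg' : ContinuousOn g' L)
    (h : ∀ z ∈ K, Complex.exp (g z) = f z) (h' : ∀ z ∈ L, Complex.exp (g' z) = f z) :
    ∃ G : ℂ → ℂ, ContinuousOn G (K ∪ L) ∧ ∀ z ∈ K ∪ L, Complex.exp (G z) = f z := by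
  classical
  obtain ⟨c, hc1, hc⟩ : ∃ c : ℂ, Complex.exp c = 1 ∧ ∀ z ∈ K ∩ L, g z = g' z + c := by
    rcases (K ∩ L).eq_empty_or_nonempty with he | ⟨p, hp⟩
    · exact ⟨0, by simp, by simp [he]⟩
    · refine ⟨g p - g' p, ?_, fun z hz => ?_⟩
      · rw [Complex.exp_sub, h p hp.1, ← h' p hp.2, div_self (Complex.exp_ne_zero _)]
      · have := JA_diff_const hKL (hg.mono inter_subset_left) (hg'.mono inter_subset_right)
          (fun z hz => by rw [h z hz.1, h' z hz.2]) hz hp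
        linear_combination this
  have e1 : EqOn (K.piecewise g (fun z => g' z + c)) g K := fun z hz => by simp [hz]
  have e2 : EqOn (K.piecewise g (fun z => g' z + c)) (fun z => g' z + c) L := fun z hz => by
    by_cases hzK : z ∈ K
    · simp [hzK, hc z ⟨hzK, hz⟩]
    · simp [hzK]
  refine ⟨K.piecewise g (fun z => g' z + c), ?_, ?_⟩
  · exact (hg.congr e1).union_of_isClosed ((hg'.add continuousOn_const).congr e2) hK hL
  · rintro z (hz | hz)
    · rw [e1 hz, h z hz]
    · rw [e2 hz]; simp only; rw [Complex.exp_add, hc1, mul_one, h' z hz]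

lemma JA_descend {γ : ℝ → ℂ} {C : Set ℂ} (hγ : Continuous γ) (h01 : γ 0 = γ 1)
    (hinj : InjOn γ (Ico 0 1)) (hC : γ '' Icc 0 1 = C) {ψ : ℝ → ℂ}
    (hψ : Continuous ψ) (hψ01 : ψ 0 = ψ 1) :
    ∃ g : ℂ → ℂ, ContinuousOn g C ∧ ∀ t ∈ Icc (0:ℝ) 1, g (γ t) = ψ t := by
  classical
  have hs : ∀ z ∈ C, ∃ t ∈ Icc (0:ℝ) 1, γ t = z := fun z hz => by rw [← hC] at hz; exact hz
  choose! τ hτ hτe using hs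
  have hm : ∀ t ∈ Icc (0:ℝ) 1, γ t ∈ C := fun t ht => hC ▸ mem_image_of_mem γ ht
  -- reduce `1` to `0`
  have red : ∀ t ∈ Icc (0:ℝ) 1, ∃ s ∈ Ico (0:ℝ) 1, γ s = γ t ∧ ψ s = ψ t := by
    intro t ht
    rcases eq_or_lt_of_le ht.2 with h | h
    · exact ⟨0, by simp, by rw [h, h01], by rw [h, hψ01]⟩
    · exact ⟨t, ⟨ht.1, h⟩, rfl, rfl⟩
  have hg : ∀ t ∈ Icc (0:ℝ) 1, ψ (τ (γ t)) = ψ t := by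
    intro t ht
    obtain ⟨s, hs, h1, h2⟩ := red t ht
    obtain ⟨s', hs', h1', h2'⟩ := red _ (hτ _ (hm t ht))
    have : s = s' := hinj hs hs' (by rw [h1, h1', hτe _ (hm t ht)])
    rw [← h2, ← h2', this]
  refine ⟨fun z => ψ (τ z), ?_, hg⟩
  rw [continuousOn_iff_continuous_domRestrict]
  let q : Icc (0:ℝ) 1 → C := fun t => ⟨γ t, hm t t.2⟩
  have hq : Continuous q := by
    apply Continuous.subtype_mk
    exact hγ.comp continuous_subtype_val
  have hqs : Function.Surjective q := by
    rintro ⟨z, hz⟩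
    exact ⟨⟨τ z, hτ z hz⟩, Subtype.ext (hτe z hz)⟩
  have hqq := Topology.IsQuotientMap.of_surjective_continuous hqs hq
  rw [hqq.continuous_iff]
  have : (C.domRestrict fun z => ψ (τ z)) ∘ q = fun t : Icc (0:ℝ) 1 => ψ t := by
    funext t
    exact hg t t.2
  rw [this]
  exact hψ.comp continuous_subtype_val

lemma JA_comb {γ : ℝ → ℂ} {C : Set ℂ} (hγ : Continuous γ) (h01 : γ 0 = γ 1)
    (hinj : InjOn γ (Ico 0 1)) (hC : γ '' Icc 0 1 = C) (hmem : ∀ t, γ t ∈ C) {f₁ f₂ : ℂ → ℂ}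
    (hf₁ : ContinuousOn f₁ C) (hf₂ : ContinuousOn f₂ C) (h₁ : ∀ z ∈ C, f₁ z ≠ 0)
    (h₂ : ∀ z ∈ C, f₂ z ≠ 0) :
    ∃ m n : ℤ, (∃ g : ℂ → ℂ, ContinuousOn g C ∧
        ∀ z ∈ C, Complex.exp (g z) = f₁ z ^ n * f₂ z ^ (-m)) ∧
      (m = 0 → ∃ g : ℂ → ℂ, ContinuousOn g C ∧ ∀ z ∈ C, Complex.exp (g z) = f₁ z) := by
  obtain ⟨φ₁, hφ₁, e₁⟩ := JA_lift (hf₁.comp_continuous hγ hmem) (fun t => h₁ _ (hmem t))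
  obtain ⟨φ₂, hφ₂, e₂⟩ := JA_lift (hf₂.comp_continuous hγ hmem) (fun t => h₂ _ (hmem t))
  simp only [Function.comp] at e₁ e₂
  obtain ⟨m, hm⟩ := Complex.exp_eq_exp_iff_exists_int.1
    (show Complex.exp (φ₁ 0) = Complex.exp (φ₁ 1) by rw [e₁, e₁, h01])
  obtain ⟨n, hn⟩ := Complex.exp_eq_exp_iff_exists_int.1
    (show Complex.exp (φ₂ 0) = Complex.exp (φ₂ 1) by rw [e₂, e₂, h01])
  refine ⟨m, n, ?_, ?_⟩
  · obtain ⟨g, hg, hgψ⟩ := JA_descend hγ h01 hinj hC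
      (ψ := fun t => (n : ℂ) * φ₁ t + ((-m : ℤ) : ℂ) * φ₂ t) (by fun_prop) (by
        simp only [hm, hn]; push_cast; ring)
    refine ⟨g, hg, fun z hz => ?_⟩
    rw [← hC] at hz
    obtain ⟨t, ht, rfl⟩ := hz
    rw [hgψ t ht, Complex.exp_add, Complex.exp_int_mul, Complex.exp_int_mul, e₁, e₂]
  · intro h0
    obtain ⟨g, hg, hgψ⟩ := JA_descend hγ h01 hinj hC (ψ := φ₁) hφ₁ (by simp [hm, h0])
    refine ⟨g, hg, fun z hz => ?_⟩
    rw [← hC] at hz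
    obtain ⟨t, ht, rfl⟩ := hz
    rw [hgψ t ht, e₁]

lemma JA_frontier {K : Set ℂ} (hK : IsClosed K) (a : ℂ) :
    frontier (connectedComponentIn Kᶜ a) ⊆ K := by
  intro z hz
  by_contra hzK
  have ho := hK.isOpen_compl.connectedComponentIn (x := a)
  have ho' := hK.isOpen_compl.connectedComponentIn (x := z)
  rw [ho.frontier_eq] at hz
  obtain ⟨w, hw1, hw2⟩ := mem_closure_iff.1 hz.1 _ ho' (mem_connectedComponentIn hzK)
  apply hz.2
  rw [connectedComponentIn_eq hw2, ← connectedComponentIn_eq hw1]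
  exact mem_connectedComponentIn hzK

lemma JA_closure {K : Set ℂ} (hK : IsClosed K) {a b : ℂ} (hb : b ∉ K)
    (hab : b ∉ connectedComponentIn Kᶜ a) : b ∉ closure (connectedComponentIn Kᶜ a) := by
  intro h
  have ho := hK.isOpen_compl.connectedComponentIn (x := a)
  exact hb (JA_frontier hK a (by rw [ho.frontier_eq]; exact ⟨h, hab⟩))

/-- at most one bounded component -/
lemma JA_unique {γ : ℝ → ℂ} {C : Set ℂ} (hγ : Continuous γ) (h01 : γ 0 = γ 1)
    (hinj : InjOn γ (Ico 0 1)) (hC : γ '' Icc 0 1 = C) (hmem : ∀ t, γ t ∈ C)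
    {p v : ℂ} (hp : p ∉ C) (hv : v ∉ C)
    (hpb : Bornology.IsBounded (connectedComponentIn Cᶜ p))
    (hvb : Bornology.IsBounded (connectedComponentIn Cᶜ v)) :
    v ∈ connectedComponentIn Cᶜ p := by
  by_contra hvp
  have hpv : p ∉ connectedComponentIn Cᶜ v := fun h => hvp (by
    rw [← connectedComponentIn_eq h]; exact mem_connectedComponentIn hv)
  have hCc : IsClosed C := hC ▸ (isCompact_Icc.image hγ).isClosed
  have hne : ∀ a ∉ C, ∀ z ∈ C, z - a ≠ 0 := fun a ha z hz h => ha (by rwa [← sub_eq_zero.1 h])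
  have hcl : ∀ a b, b ∉ C → b ∉ connectedComponentIn Cᶜ a →
      ∀ z ∈ closure (connectedComponentIn Cᶜ a), z - b ≠ 0 := fun a b hb hab z hz h =>
    JA_closure hCc hb hab (by rwa [← sub_eq_zero.1 h])
  obtain ⟨m, n, ⟨g, hg, hge⟩, hm⟩ := JA_comb hγ h01 hinj hC hmem (f₁ := fun z => z - p)
    (f₂ := fun z => z - v) (by fun_prop) (by fun_prop) (hne p hp) (hne v hv)
  have om : -m = 0 := JA_eil (hCc.isOpen_compl.connectedComponentIn (x := v)) hvb
    (mem_connectedComponentIn hv) (r := fun z => (z - p) ^ n) (g := g)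
    (ContinuousOn.zpow₀ (by fun_prop) _ (fun z hz => Or.inl (hcl v p hp hpv z hz)))
    (fun z hz => zpow_ne_zero _ (hcl v p hp hpv z hz))
    (hg.mono (JA_frontier hCc v)) (fun z hz => by rw [hge z (JA_frontier hCc v hz), mul_comm])
  obtain ⟨g', hg', hge'⟩ := hm (by omega)
  have : (1 : ℤ) = 0 := JA_eil (hCc.isOpen_compl.connectedComponentIn (x := p)) hpb
    (mem_connectedComponentIn hp) (r := fun z => 1) (g := g') continuousOn_const (by simp)
    (hg'.mono (JA_frontier hCc p)) (fun z hz => by rw [hge' z (JA_frontier hCc p hz)]; simp)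
  omega

lemma JA_unbounded {C : Set ℂ} (hC : IsCompact C) {u v : ℂ}
    (hub : ¬ Bornology.IsBounded (connectedComponentIn Cᶜ u))
    (hvb : ¬ Bornology.IsBounded (connectedComponentIn Cᶜ v)) :
    v ∈ connectedComponentIn Cᶜ u := by
  obtain ⟨R, hR0, hR⟩ := hC.isBounded.subset_ball_lt 0 0
  have hE : IsPreconnected (Complex.exp '' {z | Real.log R < z.re}) :=
    (convex_halfSpace_re_gt _).isPreconnected.image _ Complex.continuous_exp.continuousOn
  have hsub : ∀ z, R < ‖z‖ → z ∈ Complex.exp '' {z | Real.log R < z.re} := by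
    intro z hz
    have : z ≠ 0 := norm_pos_iff.1 (hR0.trans hz)
    exact ⟨Complex.log z, by simpa [Complex.log_re] using Real.log_lt_log hR0 hz,
      Complex.exp_log this⟩
  have hEC : Complex.exp '' {z | Real.log R < z.re} ⊆ Cᶜ := by
    rintro _ ⟨z, hz, rfl⟩ h
    have := hR h
    rw [mem_ball_zero_iff, Complex.norm_exp] at this
    have h2 : Real.exp (Real.log R) < Real.exp z.re := Real.exp_lt_exp.2 hz
    rw [Real.exp_log hR0] at h2
    linarith
  have far : ∀ u, ¬ Bornology.IsBounded (connectedComponentIn Cᶜ u) →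
      ∃ w ∈ connectedComponentIn Cᶜ u, R < ‖w‖ := by
    intro u hu
    by_contra! h
    exact hu (isBounded_iff_forall_norm_le.2 ⟨R, h⟩)
  obtain ⟨w, hw, hwR⟩ := far u hub
  obtain ⟨w', hw', hwR'⟩ := far v hvb
  have := hE.subset_connectedComponentIn (hsub w hwR) hEC (hsub w' hwR')
  have hv : v ∈ Cᶜ := connectedComponentIn_nonempty_iff.1 ⟨w', hw'⟩
  rw [connectedComponentIn_eq hw, connectedComponentIn_eq this, ← connectedComponentIn_eq hw']
  exact mem_connectedComponentIn hv

lemma JA_local {γ : ℝ → ℂ} {C : Set ℂ} (hγ : Continuous γ) (h01 : γ 0 = γ 1)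
    (hinj : InjOn γ (Ico 0 1)) (hC : γ '' Icc 0 1 = C) {ε : ℝ} (hε : 0 < ε) :
    ∃ δ > 0, δ < ε ∧ ∀ u ∈ Metric.ball (γ 0) δ, ∀ v ∈ Metric.ball (γ 0) δ, u ∉ C → v ∉ C →
      v ∈ connectedComponentIn Cᶜ u → ∃ E : Set ℂ, IsConnected E ∧ u ∈ E ∧ v ∈ E ∧
        E ⊆ Metric.ball (γ 0) ε ∧ E ⊆ Cᶜ := by
  set x := γ 0 with hx
  have near : ∀ s, γ s = x → ∃ η > 0, ∀ t, |t - s| < η → γ t ∈ Metric.ball x ε := by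
    intro s hs
    obtain ⟨η, h, h'⟩ := Metric.continuous_iff.1 hγ s ε hε
    exact ⟨η, h, fun t ht => by rw [Metric.mem_ball, ← hs]; exact h' t ht⟩
  obtain ⟨η₁, h1, h1'⟩ := near 0 rfl
  obtain ⟨η₂, h2, h2'⟩ := near 1 h01.symm
  obtain ⟨η, hη0, hη1, hη2, hη3⟩ : ∃ η > 0, η < η₁ ∧ η < η₂ ∧ η < 1 / 2 := by
    refine ⟨min (min η₁ η₂) (1/2) / 2, by positivity, ?_, ?_, ?_⟩ <;>
    · have := min_le_left (min η₁ η₂) (1/2)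
      have := min_le_right (min η₁ η₂) (1/2)
      have := min_le_left η₁ η₂
      have := min_le_right η₁ η₂
      have : 0 < min (min η₁ η₂) (1/2) := by positivity
      linarith
  set L := γ '' Icc η (1 - η) with hL
  have hLC : L ⊆ C := hC ▸ image_mono (Icc_subset_Icc hη0.le (by linarith))
  have hCL : ∀ z ∈ C, z ∉ Metric.ball x ε → z ∈ L := by
    intro z hz hzb
    rw [← hC] at hz
    obtain ⟨t, ht, rfl⟩ := hz
    refine ⟨t, ⟨?_, ?_⟩, rfl⟩
    · by_contra! h
      exact hzb (h1' t (by rw [abs_lt]; constructor <;> linarith [ht.1]))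
    · by_contra! h
      exact hzb (h2' t (by rw [abs_lt]; constructor <;> linarith [ht.2]))
  have hLc : IsCompact L := isCompact_Icc.image hγ
  have hLp : IsPreconnected L := isPreconnected_Icc.image _ hγ.continuousOn
  have hxL : x ∉ L := by
    rintro ⟨t, ht, h⟩
    have := hinj (show t ∈ Ico (0:ℝ) 1 from ⟨by linarith [ht.1], by linarith [ht.2]⟩)
      (by simp : (0:ℝ) ∈ Ico (0:ℝ) 1) h
    linarith [ht.1]
  have hCc : IsClosed C := hC ▸ (isCompact_Icc.image hγ).isClosed
  obtain ⟨δ', hδ', hδL⟩ := Metric.isOpen_iff.1 hLc.isClosed.isOpen_compl x hxL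
  refine ⟨min δ' (ε / 2), by positivity, (min_le_right _ _).trans_lt (by linarith), ?_⟩
  intro u hu v hv huC hvC huv
  set S := Metric.sphere x ε
  have hballε : Metric.ball x (min δ' (ε / 2)) ⊆ Metric.ball x ε :=
    Metric.ball_subset_ball ((min_le_right _ _).trans (by linarith))
  have hballK : Metric.ball x (min δ' (ε / 2)) ⊆ (S ∪ L)ᶜ := by
    rintro z hz (h | h)
    · have := hballε hz
      rw [Metric.mem_ball] at this
      rw [Metric.mem_sphere] at h
      linarith
    · exact hδL (Metric.ball_subset_ball (min_le_left _ _) hz) h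
  have hSc : IsClosed (S ∪ L) := Metric.isClosed_sphere.union hLc.isClosed
  have hint : C ∩ (S ∪ L) = L := by
    ext z
    constructor
    · rintro ⟨hz, h | h⟩
      · exact hCL z hz (fun hb => by
          rw [Metric.mem_ball] at hb; rw [Metric.mem_sphere] at h; linarith)
      · exact h
    · intro h; exact ⟨hLC h, Or.inr h⟩
  obtain ⟨g, hg, hge⟩ := JA_log_of_conn hCc isPreconnected_connectedComponentIn
    (connectedComponentIn_subset _ _) (mem_connectedComponentIn huC) huv
  obtain ⟨g', hg', hge'⟩ := JA_log_of_conn hSc (convex_ball _ _).isPreconnected hballK hu hv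
  obtain ⟨G, hG, hGe⟩ := JA_glue hCc hSc (by rw [hint]; exact hLp) hg hg' hge hge'
  set K := C ∪ (S ∪ L) with hK
  have hKc : IsClosed K := hCc.union hSc
  have huK : u ∉ K := fun h => h.elim huC (hballK hu)
  have hvK : v ∉ K := fun h => h.elim hvC (hballK hv)
  have hDb : connectedComponentIn Kᶜ u ⊆ Metric.ball x ε := by
    apply isPreconnected_connectedComponentIn.subset_left_of_subset_union Metric.isOpen_ball
      (Metric.isClosed_closedBall (x := x) (ε := ε)).isOpen_compl
    · exact disjoint_compl_right.mono_left Metric.ball_subset_closedBall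
    · intro z hz
      have h1 : z ∉ S := fun h => connectedComponentIn_subset _ _ hz (Or.inr (Or.inl h))
      rcases lt_trichotomy (dist z x) ε with h | h | h
      · exact Or.inl h
      · exact absurd h h1
      · exact Or.inr (fun h' => by rw [Metric.mem_closedBall] at h'; linarith)
    · exact ⟨u, mem_connectedComponentIn huK, hballε hu⟩
  refine ⟨connectedComponentIn Kᶜ u, ⟨⟨u, mem_connectedComponentIn huK⟩,
    isPreconnected_connectedComponentIn⟩, mem_connectedComponentIn huK, ?_, hDb,
    (connectedComponentIn_subset _ _).trans (compl_subset_compl.2 subset_union_left)⟩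
  by_contra hvD
  have hcl : ∀ z ∈ closure (connectedComponentIn Kᶜ u), z - v ≠ 0 := fun z hz h =>
    JA_closure hKc hvK hvD (by rwa [← sub_eq_zero.1 h])
  have : (1 : ℤ) = 0 := JA_eil (hKc.isOpen_compl.connectedComponentIn (x := u))
    (Metric.isBounded_ball.subset hDb) (mem_connectedComponentIn huK)
    (r := fun z => (z - v)⁻¹) (g := G) (ContinuousOn.inv₀ (by fun_prop) hcl)
    (fun z hz => inv_ne_zero (hcl z hz)) (hG.mono (JA_frontier hKc u))
    (fun z hz => by rw [hGe z (JA_frontier hKc u hz), zpow_one, div_eq_mul_inv])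
  omega

lemma JA_access {γ : ℝ → ℂ} {C : Set ℂ} (hγ : Continuous γ) (h01 : γ 0 = γ 1)
    (hinj : InjOn γ (Ico 0 1)) (hC : γ '' Icc 0 1 = C) {A : Set ℂ} (hAC : A ⊆ Cᶜ)
    (h1 : ∀ u ∈ A, ∀ v ∈ A, v ∈ connectedComponentIn Cᶜ u)
    (h2 : ∀ u ∈ A, connectedComponentIn Cᶜ u ⊆ A) : LocConnAccess A (γ 0) := by
  intro U hU hxU
  obtain ⟨ε, hε, hεU⟩ := Metric.isOpen_iff.1 hU _ hxU
  obtain ⟨δ, hδ, hδε, h⟩ := JA_local hγ h01 hinj hC hε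
  refine ⟨Metric.ball (γ 0) δ, Metric.isOpen_ball, Metric.mem_ball_self hδ,
    (Metric.ball_subset_ball hδε.le).trans hεU, ?_⟩
  rintro u ⟨hu, huA⟩ v ⟨hv, hvA⟩
  obtain ⟨E, hE, huE, hvE, hEb, hEC⟩ := h u hu v hv (hAC huA) (hAC hvA) (h1 u huA v hvA)
  exact ⟨E, hE, huE, hvE, subset_inter (hEb.trans hεU)
    ((hE.isPreconnected.subset_connectedComponentIn huE hEC).trans (h2 u huA))⟩

lemma JA_main {γ : ℝ → ℂ} {C : Set ℂ} (hγ : Continuous γ) (h01 : γ 0 = γ 1)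
    (hinj : InjOn γ (Ico 0 1)) (hC : γ '' Icc 0 1 = C) (hmem : ∀ t, γ t ∈ C)
    {p : ℂ} (hp : p ∉ C) (hpb : Bornology.IsBounded (connectedComponentIn Cᶜ p)) :
    LocConnAccess (connectedComponentIn Cᶜ p) (γ 0) ∧
      LocConnAccess (connectedComponentIn Cᶜ p ∪ C)ᶜ (γ 0) := by
  have hCk : IsCompact C := hC ▸ isCompact_Icc.image hγ
  constructor
  · apply JA_access hγ h01 hinj hC (connectedComponentIn_subset _ _)
    · intro u hu v hv
      rwa [← connectedComponentIn_eq hu]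
    · intro u hu
      rw [← connectedComponentIn_eq hu]
  · have hub : ∀ u ∈ (connectedComponentIn Cᶜ p ∪ C)ᶜ,
        ¬ Bornology.IsBounded (connectedComponentIn Cᶜ u) := fun u hu hb =>
      hu (Or.inl (JA_unique hγ h01 hinj hC hmem hp (fun h => hu (Or.inr h)) hpb hb))
    apply JA_access hγ h01 hinj hC (compl_subset_compl.2 subset_union_right)
    · intro u hu v hv
      exact JA_unbounded hCk (hub u hu) (hub v hv)
    · rintro u hu w hw (h | h)
      · apply hu
        left
        rw [connectedComponentIn_eq h, ← connectedComponentIn_eq hw]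
        exact mem_connectedComponentIn (fun h => hu (Or.inr h))
      · exact connectedComponentIn_subset _ _ hw h

lemma JA_transport {X Y : Type*} [TopologicalSpace X] [TopologicalSpace Y] (e : X ≃ₜ Y)
    {A : Set X} {x : X} (h : LocConnAccess (e '' A) (e x)) : LocConnAccess A x := by
  intro U hU hx
  obtain ⟨G, hG, hxG, hGU, h⟩ := h (e '' U) (e.isOpenMap U hU) (mem_image_of_mem e hx)
  refine ⟨e ⁻¹' G, hG.preimage e.continuous, hxG, fun z hz => ?_, ?_⟩
  · simpa using hGU hz
  · rintro u ⟨hu, huA⟩ v ⟨hv, hvA⟩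
    obtain ⟨E, hE, huE, hvE, hEU⟩ :=
      h (e u) ⟨hu, mem_image_of_mem e huA⟩ (e v) ⟨hv, mem_image_of_mem e hvA⟩
    refine ⟨e ⁻¹' E, (e.isConnected_preimage).2 hE, huE, hvE, fun z hz => ?_⟩
    simpa using hEU hz

lemma JA_param (e : Plane ≃ₗᵢ[ℝ] ℂ) {C : Set Plane} (h : ↥unitCircle ≃ₜ ↥C) {x : Plane}
    (hx : x ∈ C) : ∃ γ : ℝ → ℂ, Continuous γ ∧ γ 0 = e x ∧ γ 0 = γ 1 ∧ InjOn γ (Ico 0 1) ∧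
      γ '' Icc 0 1 = e '' C ∧ ∀ t, γ t ∈ e '' C := by
  have hmem : ∀ s : ℝ, e.symm (Complex.exp (s * Complex.I)) ∈ unitCircle := by
    intro s
    rw [mem_sphere_zero_iff_norm, e.symm.norm_map, Complex.norm_exp_ofReal_mul_I]
  let c : ℝ → unitCircle := fun s => ⟨e.symm (Complex.exp (s * Complex.I)), hmem s⟩
  have hc : Continuous c := by
    apply Continuous.subtype_mk
    exact e.symm.continuous.comp (by fun_prop)
  have hcs : ∀ y : unitCircle, ∃ s : ℝ, c s = y := by
    intro y
    refine ⟨(e y).arg, Subtype.ext ?_⟩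
    have hn : ‖e y‖ = 1 := by rw [e.norm_map]; exact mem_sphere_zero_iff_norm.1 y.2
    have := Complex.norm_mul_exp_arg_mul_I (e y)
    rw [hn] at this
    simp only [Complex.ofReal_one, one_mul] at this
    simp only [c, this, e.symm_apply_apply]
  have hci : ∀ s t, c s = c t ↔ ∃ n : ℤ, s = t + n * (2 * Real.pi) := by
    intro s t
    simp only [c, Subtype.mk.injEq, e.symm.injective.eq_iff]
    rw [Complex.exp_eq_exp_iff_exists_int]
    refine exists_congr fun n => ⟨fun h => ?_, fun h => ?_⟩
    · have := congrArg Complex.im h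
      simpa using this
    · rw [h]; push_cast; ring
  obtain ⟨θ, hθ⟩ := hcs (h.symm ⟨x, hx⟩)
  have hpi := Real.pi_pos
  have hγ1 : Function.Injective (fun y : unitCircle => e (h y)) := fun y y' hyy =>
    h.injective (Subtype.ext (e.injective hyy))
  refine ⟨fun t => e (h (c (θ + 2 * Real.pi * t))), ?_, ?_, ?_, ?_, ?_, ?_⟩
  · exact e.continuous.comp (continuous_subtype_val.comp (h.continuous.comp (hc.comp (by fun_prop))))
  · simp [hθ]
  · have : c (θ + 2 * Real.pi * 0) = c (θ + 2 * Real.pi * 1) :=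
      (hci _ _).2 ⟨-1, by push_cast; ring⟩
    simp only [this]
  · intro s hs t ht hst
    obtain ⟨n, hn⟩ := (hci _ _).1 (hγ1 hst)
    have h1 : s = t + n := by
      have : 2 * Real.pi * s = 2 * Real.pi * (t + n) := by linarith
      exact mul_left_cancel₀ (by positivity) this
    have h2 : (n : ℝ) < 1 := by linarith [hs.2, ht.1]
    have h3 : (-1 : ℝ) < n := by linarith [hs.1, ht.2]
    have h2' : n < 1 := by exact_mod_cast h2
    have h3' : -1 < n := by exact_mod_cast h3
    have : n = 0 := by omega
    simpa [this] using h1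
  · apply Subset.antisymm
    · rintro _ ⟨t, _, rfl⟩
      exact mem_image_of_mem e (h _).2
    · rintro _ ⟨z, hz, rfl⟩
      obtain ⟨s, hs⟩ := hcs (h.symm ⟨z, hz⟩)
      refine ⟨Int.fract ((s - θ) / (2 * Real.pi)), ⟨Int.fract_nonneg _, (Int.fract_lt_one _).le⟩, ?_⟩
      have : c (θ + 2 * Real.pi * Int.fract ((s - θ) / (2 * Real.pi))) = c s := by
        refine (hci _ _).2 ⟨-⌊(s - θ) / (2 * Real.pi)⌋, ?_⟩
        rw [Int.fract]
        push_cast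
        field_simp
        ring
      simp only [this, hs, Homeomorph.apply_symm_apply]
  · intro t
    exact mem_image_of_mem e (h _).2

theorem jordan_curve_locConnAccess
    (C : Set Plane) (hC : Nonempty (↥unitCircle ≃ₜ ↥C))
    (B : Set Plane)
    (hBcomp : ∃ x ∈ Cᶜ, B = connectedComponentIn Cᶜ x)
    (hBbd : Bornology.IsBounded B) :
    ∀ x ∈ C, LocConnAccess B x ∧ LocConnAccess (B ∪ C)ᶜ x := by
  intro x hx
  obtain ⟨h⟩ := hC
  obtain ⟨p, hp, rfl⟩ := hBcomp
  let e : Plane ≃ₗᵢ[ℝ] ℂ := Complex.orthonormalBasisOneI.repr.symm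
  obtain ⟨γ, hγ, hγx, h01, hinj, hγC, hmem⟩ := JA_param e h hx
  have hB : e '' connectedComponentIn Cᶜ p = connectedComponentIn (e '' C)ᶜ (e p) := by
    rw [← image_compl_eq e.bijective]
    exact e.toHomeomorph.image_connectedComponentIn hp
  have hep : e p ∉ e '' C := by
    rintro ⟨q, hq, hqp⟩
    exact hp (e.injective hqp ▸ hq)
  have hb : Bornology.IsBounded (connectedComponentIn (e '' C)ᶜ (e p)) := by
    rw [← hB]
    exact e.lipschitz.isBounded_image hBbd
  obtain ⟨m1, m2⟩ := JA_main hγ h01 hinj hγC hmem hep hb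
  rw [hγx] at m1 m2
  constructor
  · apply JA_transport e.toHomeomorph
    rw [← hB] at m1
    exact m1
  · apply JA_transport e.toHomeomorph
    rw [← hB, ← image_union, ← image_compl_eq e.bijective] at m2
    exact m2
end
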